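/- arXiv:1403.2980 — 6 statements merged into one kernel-verified Lean document; each statement's English description precedes it below -/
import Mathlib

section
/- For every finite set B ⊆ ℤ³ there exist finitely many finite sets S₁, …, Sₘ ⊆ ℝ³ such that the set P = ⋃ᵢ₌₁ᵐ convexHull(Sᵢ) (a finite union of convex polytopes) is homotopy equivalent to the continuous analog C(B), and the frontier of P in ℝ³ is a topological 2-manifold. (Existence form of the main theorem: every 3D binary digital image can be repaired into a well-composed polyhedral object P(I) homotopy equivalent to its cubical complex Q(I).) -/
/-- The continuous analog `C(B)` of a 3D binary image with foreground `B ⊆ ℤ³`: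
the union of the closed axis-parallel unit cubes (voxels) centered at the points of `B`. -/
def contAnalog (B : Set (Fin 3 → ℤ)) : Set (Fin 3 → ℝ) :=
  ⋃ b ∈ B, {x : Fin 3 → ℝ | ∀ j, |x j - (b j : ℝ)| ≤ 1 / 2}

/-- A subset `S` of `ℝ³` (with the subspace topology) is a topological 2-manifold:
every point of `S` has an open neighborhood in `S` homeomorphic to an open subset of `ℝ²`. -/
def Is2Manifold (S : Set (Fin 3 → ℝ)) : Prop :=
  ∀ x : S, ∃ (U : Set S) (V : Set (Fin 2 → ℝ)),
    IsOpen U ∧ IsOpen V ∧ x ∈ U ∧ Nonempty (U ≃ₜ V)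

open Topology Set

/-- The union of the closed cubes of radius `r` (in the sup norm) centered at the points of `B`. -/
def cubeUnion (B : Set (Fin 3 → ℤ)) (r : ℝ) : Set (Fin 3 → ℝ) :=
  ⋃ b ∈ B, {x : Fin 3 → ℝ | ∀ j, |x j - (b j : ℝ)| ≤ r}

lemma mem_cubeUnion {B : Set (Fin 3 → ℤ)} {r : ℝ} {x : Fin 3 → ℝ} :
    x ∈ cubeUnion B r ↔ ∃ b ∈ B, ∀ j, |x j - (b j : ℝ)| ≤ r := by
  simp [cubeUnion]

lemma cube_eq_pi (b : Fin 3 → ℤ) (r : ℝ) :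
    {x : Fin 3 → ℝ | ∀ j, |x j - (b j : ℝ)| ≤ r} =
      univ.pi fun j => Icc ((b j : ℝ) - r) (b j + r) := by
  ext x
  simp only [mem_ofPred_eq, mem_univ_pi, mem_Icc, abs_le]
  exact forall_congr' fun j => by constructor <;> rintro ⟨h₁, h₂⟩ <;> constructor <;> linarith

lemma convex_cube (b : Fin 3 → ℤ) (r : ℝ) :
    Convex ℝ {x : Fin 3 → ℝ | ∀ j, |x j - (b j : ℝ)| ≤ r} := by
  rw [cube_eq_pi]
  exact convex_pi fun _ _ => convex_Icc _ _

lemma isClosed_cubeUnion {B : Set (Fin 3 → ℤ)} (hB : B.Finite) (r : ℝ) :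
    IsClosed (cubeUnion B r) := by
  refine hB.isClosed_biUnion fun b _ => ?_
  rw [cube_eq_pi]
  exact isClosed_set_pi fun _ _ => isClosed_Icc

/-- The vertices of the closed cube of radius `r` centered at `b`. -/
def cubeVertices (b : Fin 3 → ℤ) (r : ℝ) : Set (Fin 3 → ℝ) :=
  univ.pi fun j => {(b j : ℝ) - r, (b j : ℝ) + r}

lemma finite_cubeVertices (b : Fin 3 → ℤ) (r : ℝ) : (cubeVertices b r).Finite :=
  Set.Finite.pi fun _ => toFinite _

lemma convexHull_cubeVertices (b : Fin 3 → ℤ) {r : ℝ} (hr : 0 ≤ r) :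
    convexHull ℝ (cubeVertices b r) = {x : Fin 3 → ℝ | ∀ j, |x j - (b j : ℝ)| ≤ r} := by
  rw [cube_eq_pi, cubeVertices, convexHull_pi]
  congr 1
  ext1 j
  rw [convexHull_pair, segment_eq_Icc (by linarith)]

/-- If `ρ` maps `P` into `S ⊆ P` and the segments from `ρ x` to `x` stay in `P` for `x ∈ P` and in
`S` for `x ∈ S`, then `P` and `S` are homotopy equivalent. -/
lemma nonempty_homotopyEquiv_of_segment_subset {E : Type*} [AddCommGroup E] [Module ℝ E]
    [TopologicalSpace E] [IsTopologicalAddGroup E] [ContinuousSMul ℝ E] {P S : Set E}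
    (hSP : S ⊆ P) {ρ : E → E} (hρ : Continuous ρ) (hρPS : MapsTo ρ P S)
    (hP : ∀ x ∈ P, segment ℝ (ρ x) x ⊆ P) (hS : ∀ x ∈ S, segment ℝ (ρ x) x ⊆ S) :
    Nonempty (ContinuousMap.HomotopyEquiv P S) := by
  have key : ∀ {T : Set E} (f : C(T, T)), (∀ x, (f x : E) = ρ x) →
      (∀ x ∈ T, segment ℝ (ρ x) x ⊆ T) → f.Homotopic (ContinuousMap.id T) := by
    intro T f hf hT
    refine ⟨⟨⟨fun q => ⟨AffineMap.lineMap (ρ q.2) (q.2 : E) (q.1 : ℝ), hT _ q.2.2 ?_⟩, ?_⟩,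
      ?_, ?_⟩⟩
    · rw [segment_eq_image_lineMap]
      exact mem_image_of_mem _ q.1.2
    · simp only [AffineMap.lineMap_apply_module]
      fun_prop
    · intro x
      ext1
      simp [hf]
    · intro x
      ext1
      simp
  exact ⟨{
    toFun := ⟨hρPS.restrict, hρ.restrict hρPS⟩
    invFun := ⟨inclusion hSP, continuous_inclusion hSP⟩
    left_inv := key _ (fun _ => rfl) hP
    right_inv := key _ (fun _ => rfl) hS }⟩

/-- A degree one map of the line that collapses `[k + 1/4, k + 3/4]` to `k + 1/2` for every
integer `k`. -/
noncomputable def collapse (x : ℝ) : ℝ :=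
  x + (max (min (2 * Int.fract x) (1 / 2)) (2 * Int.fract x - 1) - Int.fract x)

lemma continuous_collapse : Continuous collapse := by
  refine continuous_id.add (ContinuousOn.comp_fract''
    (f := fun t : ℝ => max (min (2 * t) (1 / 2)) (2 * t - 1) - t) ?_ ?_)
  · fun_prop
  · norm_num

lemma abs_collapse_sub_le {x : ℝ} {k : ℤ} (h : |x - k| ≤ 3 / 4) :
    |collapse x - k| ≤ 1 / 2 := by
  have h₀ := Int.fract_nonneg x
  have h₁ := Int.fract_lt_one x
  have h₂ := Int.floor_add_fract x
  rw [collapse]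
  generalize Int.fract x = t at *
  generalize ⌊x⌋ = n at *
  rw [abs_le] at h
  have hn : n = k - 1 ∨ n = k := by
    have h₃ : (k : ℝ) - 2 < n := by linarith
    have h₄ : (n : ℝ) < k + 1 := by linarith
    have h₅ : k - 2 < n := by exact_mod_cast h₃
    have h₆ : n < k + 1 := by exact_mod_cast h₄
    omega
  rw [abs_le]
  rcases hn with rfl | rfl <;> push_cast at * <;>
    rcases max_cases (min (2 * t) (1 / 2)) (2 * t - 1) with h₃ | h₃ <;>
    rcases min_cases (2 * t) (1 / 2) with h₄ | h₄ <;> constructor <;> linarith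

lemma nonempty_homotopyEquiv_contAnalog (B : Set (Fin 3 → ℤ)) :
    Nonempty (ContinuousMap.HomotopyEquiv (cubeUnion B (3 / 4)) (contAnalog B)) := by
  have hsub : ∀ r ∈ Icc (1 / 2 : ℝ) (3 / 4), ∀ x ∈ cubeUnion B r,
      segment ℝ (fun j => collapse (x j)) x ⊆ cubeUnion B r := by
    intro r hr x hx
    obtain ⟨b, hb, h⟩ := mem_cubeUnion.1 hx
    have hc : (fun j => collapse (x j)) ∈ {y : Fin 3 → ℝ | ∀ j, |y j - (b j : ℝ)| ≤ r} :=
      fun j => (abs_collapse_sub_le ((h j).trans hr.2)).trans hr.1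
    exact fun y hy => mem_cubeUnion.2 ⟨b, hb, (convex_cube b r).segment_subset hc h hy⟩
  refine nonempty_homotopyEquiv_of_segment_subset (S := cubeUnion B (1 / 2))
    (ρ := fun x j => collapse (x j)) ?_ ?_ ?_ (hsub _ ?_) (hsub _ ?_)
  · intro x hx
    obtain ⟨b, hb, h⟩ := mem_cubeUnion.1 hx
    exact mem_cubeUnion.2 ⟨b, hb, fun j => (h j).trans (by norm_num)⟩
  · exact continuous_pi fun j => continuous_collapse.comp (continuous_apply j)
  · intro x hx
    obtain ⟨b, hb, h⟩ := mem_cubeUnion.1 hx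
    exact mem_cubeUnion.2 ⟨b, hb, fun j => abs_collapse_sub_le (h j)⟩
  all_goals norm_num

/-- A set is locally monotone at `x` if, near `x`, it is an upper set for the product order after
reversing some of the coordinates. -/
def LocallyMonotoneAt (P : Set (Fin 3 → ℝ)) (x : Fin 3 → ℝ) : Prop :=
  ∃ r > 0, ∃ σ : Fin 3 → ℝ, (∀ j, σ j * σ j = 1) ∧
    ∀ y ∈ Metric.ball x r, ∀ z ∈ Metric.ball x r, y ∈ P → (∀ j, 0 ≤ σ j * (z j - y j)) → z ∈ P

lemma locallyMonotoneAt_cubeUnion (B : Set (Fin 3 → ℤ)) (x : Fin 3 → ℝ) :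
    LocallyMonotoneAt (cubeUnion B (3 / 4)) x := by
  refine ⟨1 / 8, by norm_num, fun j => if Int.fract (x j) < 1 / 2 then 1 else -1,
    fun j => by dsimp only; split_ifs <;> norm_num, fun y hy z hz hyP hyz => ?_⟩
  obtain ⟨b, hb, h⟩ := mem_cubeUnion.1 hyP
  refine mem_cubeUnion.2 ⟨b, hb, fun j => ?_⟩
  rw [Metric.mem_ball, dist_pi_lt_iff (by norm_num)] at hy hz
  have hyj := hy j
  have hzj := hz j
  have hj := h j
  have hyzj := hyz j
  rw [Real.dist_eq, abs_lt] at hyj hzj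
  rw [abs_le] at hj ⊢
  have h₀ := Int.fract_nonneg (x j)
  have h₁ := Int.fract_lt_one (x j)
  have h₂ := Int.floor_add_fract (x j)
  dsimp only at hyzj
  generalize Int.fract (x j) = t at *
  generalize ⌊x j⌋ = n at *
  split_ifs at hyzj with ht
  · refine ⟨by linarith, ?_⟩
    by_contra! hlt
    have h₃ : (n : ℝ) < b j + 1 := by linarith
    have h₄ : (b j : ℝ) < n := by linarith
    have h₅ : n < b j + 1 := by exact_mod_cast h₃
    have h₆ : b j < n := by exact_mod_cast h₄
    omega
  · refine ⟨?_, by linarith⟩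
    by_contra! hlt
    have h₃ : (n : ℝ) + 1 < b j := by linarith
    have h₄ : (b j : ℝ) < n + 2 := by linarith
    have h₅ : n + 1 < b j := by exact_mod_cast h₃
    have h₆ : b j < n + 2 := by exact_mod_cast h₄
    omega

lemma inter_frontier_nonempty {X : Type*} [TopologicalSpace X] {P s : Set X} (hP : IsClosed P)
    (hs : IsPreconnected s) (hsP : (s ∩ P).Nonempty) (hsP' : (s ∩ Pᶜ).Nonempty) :
    (s ∩ frontier P).Nonempty := by
  by_contra hne
  have hint : ∀ y ∈ s, y ∈ P → y ∈ interior P := fun y hy hyP => by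
    by_contra hyi
    exact hne ⟨y, hy, subset_closure hyP, hyi⟩
  obtain ⟨y, hy, hyP⟩ := hsP
  obtain ⟨z, -, hz, hz'⟩ := hs (interior P) Pᶜ isOpen_interior hP.isOpen_compl
    (fun z hz => (em (z ∈ P)).imp (hint z hz) id) ⟨y, hy, hint y hy hyP⟩ hsP'
  exact hz' (interior_subset hz)

/-- Near a point where a closed set is locally monotone, its frontier is a graph over the plane
transverse to the diagonal direction of monotonicity. -/
lemma is2Manifold_frontier {P : Set (Fin 3 → ℝ)} (hP : IsClosed P)
    (h : ∀ x, LocallyMonotoneAt P x) : Is2Manifold (frontier P) := by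
  intro x
  obtain ⟨r, hr, σ, hσ, hmono⟩ := h x
  have hfP : frontier P ⊆ P := hP.frontier_subset
  have hstrict : ∀ y ∈ Metric.ball (x : Fin 3 → ℝ) r, ∀ z ∈ Metric.ball (x : Fin 3 → ℝ) r,
      y ∈ P → (∀ j, 0 < σ j * (z j - y j)) → z ∉ frontier P := by
    intro y hy z hz hyP hyz hzf
    refine hzf.2 (mem_interior_iff_mem_nhds.2 ?_)
    have hopen : ∀ᶠ w in 𝓝 z, ∀ j, 0 < σ j * (w j - y j) :=
      Filter.eventually_all.2 fun j => (continuous_const.mul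
        ((continuous_apply j).sub continuous_const)).continuousAt.eventually
          (lt_mem_nhds (hyz j))
    filter_upwards [hopen, Metric.isOpen_ball.mem_nhds hz] with w hw hwb
    exact hmono y hy w hwb hyP fun j => (hw j).le
  let U : Set (frontier P) := {y | (y : Fin 3 → ℝ) ∈ Metric.ball (x : Fin 3 → ℝ) r}
  let φ : (Fin 3 → ℝ) → Fin 2 → ℝ := fun y =>
    ![σ 0 * y 0 - σ 2 * y 2, σ 1 * y 1 - σ 2 * y 2]
  let L : (Fin 2 → ℝ) → ℝ → Fin 3 → ℝ := fun p t =>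
    ![σ 0 * (p 0 + t), σ 1 * (p 1 + t), σ 2 * t]
  have hφ : Continuous φ := continuous_pi fun i => by fin_cases i <;> simp [φ] <;> fun_prop
  have hL : ∀ p, Continuous (L p) := fun p =>
    continuous_pi fun i => by fin_cases i <;> simp [L] <;> fun_prop
  have hφL : ∀ p t, φ (L p t) = p := by
    intro p t
    ext i
    fin_cases i
    · simp [φ, L]
      linear_combination (p 0 + t) * hσ 0 - t * hσ 2
    · simp [φ, L]
      linear_combination (p 1 + t) * hσ 1 - t * hσ 2
  have hσL : ∀ p t (y : Fin 3 → ℝ), ∀ j, σ j * (L p t j - y j) =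
      (![p 0 - φ y 0, p 1 - φ y 1, 0] : Fin 3 → ℝ) j + (t - σ 2 * y 2) := by
    intro p t y j
    fin_cases j
    · simp [φ, L]
      linear_combination (p 0 + t) * hσ 0
    · simp [φ, L]
      linear_combination (p 1 + t) * hσ 1
    · simp [φ, L]
      linear_combination t * hσ 2
  have habs : ∀ j a, |σ j * a| = |a| := by
    intro j a
    rw [abs_mul, (abs_eq zero_le_one).2 (mul_self_eq_one_iff.1 (hσ j)), one_mul]
  let f : U → Fin 2 → ℝ := fun y => φ y
  have hf : Continuous f := hφ.comp (continuous_subtype_val.comp continuous_subtype_val)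
  have hinj : Function.Injective f := by
    have hlt : ∀ y z : U, f y = f z → ¬ σ 2 * (y : Fin 3 → ℝ) 2 < σ 2 * (z : Fin 3 → ℝ) 2 := by
      intro y z hyz hlt
      refine hstrict y y.2 z z.2 (hfP y.1.2) (fun j => ?_) z.1.2
      have h₀ := congrFun hyz 0
      have h₁ := congrFun hyz 1
      simp only [f, φ, Matrix.cons_val_zero, Matrix.cons_val_one] at h₀ h₁
      fin_cases j <;> simp <;> linarith
    intro y z hyz
    have h₂ := le_antisymm (not_lt.1 (hlt z y hyz.symm)) (not_lt.1 (hlt y z hyz))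
    have h₀ := congrFun hyz 0
    have h₁ := congrFun hyz 1
    simp only [f, φ, Matrix.cons_val_zero, Matrix.cons_val_one] at h₀ h₁
    have hσ' : ∀ j, σ j ≠ 0 := fun j hj => by simpa [hj] using hσ j
    refine Subtype.ext (Subtype.ext (funext fun j => mul_left_cancel₀ (hσ' j) ?_))
    match j with
    | 0 => linarith
    | 1 => linarith
    | 2 => exact h₂
  have hopen : IsOpenMap f := by
    refine IsOpenMap.of_nhds_le fun y W hW => ?_
    have hyb : (y : Fin 3 → ℝ) ∈ Metric.ball (x : Fin 3 → ℝ) r := y.2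
    obtain ⟨ε, hε, hεW⟩ := Metric.mem_nhds_iff.1 hW
    obtain ⟨δ, hδ, hδr⟩ := Metric.mem_nhds_iff.1 (Metric.isOpen_ball.mem_nhds hyb)
    obtain ⟨s, hs, hsm⟩ : ∃ s > 0, 2 * s < min ε δ :=
      ⟨min ε δ / 3, by positivity, by linarith [lt_min hε hδ]⟩
    refine Metric.mem_nhds_iff.2 ⟨s, hs, fun p hp => ?_⟩
    rw [Metric.mem_ball, dist_pi_lt_iff hs] at hp
    have hp₀ := abs_lt.1 (hp 0)
    have hp₁ := abs_lt.1 (hp 1)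
    simp only [f] at hp₀ hp₁
    set t₀ := σ 2 * (y : Fin 3 → ℝ) 2
    have hnear : ∀ t ∈ Icc (t₀ - s) (t₀ + s), dist (L p t) y < min ε δ := by
      intro t ht
      refine lt_of_le_of_lt ((dist_pi_le_iff (by linarith)).2 fun j => ?_) hsm
      rw [Real.dist_eq, ← habs j, hσL, abs_le]
      obtain ⟨ht₁, ht₂⟩ := ht
      fin_cases j <;> simp <;> constructor <;> linarith
    have hball : ∀ t ∈ Icc (t₀ - s) (t₀ + s), L p t ∈ Metric.ball (x : Fin 3 → ℝ) r :=
      fun t ht => hδr ((hnear t ht).trans_le (min_le_right _ _))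
    have hlo : t₀ - s ∈ Icc (t₀ - s) (t₀ + s) := ⟨le_rfl, by linarith⟩
    have hhi : t₀ + s ∈ Icc (t₀ - s) (t₀ + s) := ⟨by linarith, le_rfl⟩
    have hmem : L p (t₀ + s) ∈ P := by
      refine hmono y hyb _ (hball _ hhi) (hfP y.1.2) fun j => ?_
      rw [hσL]
      fin_cases j <;> simp <;> linarith
    have hnot : L p (t₀ - s) ∉ P := by
      intro hlP
      refine hstrict _ (hball _ hlo) y hyb hlP (fun j => ?_) y.1.2
      rw [← neg_sub, mul_neg, hσL]
      fin_cases j <;> simp <;> linarith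
    obtain ⟨_, ⟨t, ht, rfl⟩, htf⟩ := inter_frontier_nonempty hP
      (isPreconnected_Icc.image (L p) (hL p).continuousOn)
        ⟨_, mem_image_of_mem _ hhi, hmem⟩ ⟨_, mem_image_of_mem _ hlo, hnot⟩
    have hz : (⟨⟨L p t, htf⟩, hball t ht⟩ : U) ∈ f ⁻¹' W :=
      hεW ((hnear t ht).trans_le (min_le_left _ _))
    have := hφL p t
    simpa [f, this] using hz
  have hemb := IsOpenEmbedding.of_continuous_injective_isOpenMap hf hinj hopen
  exact ⟨U, range f, Metric.isOpen_ball.preimage continuous_subtype_val, hemb.isOpen_range,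
    Metric.mem_ball_self hr, ⟨hemb.isEmbedding.toHomeomorph⟩⟩

/-- Every finite 3D binary image can be repaired into a finite union of convex polytopes
that is homotopy equivalent to its continuous analog and whose frontier is a 2-manifold. -/
theorem repair_exists (B : Set (Fin 3 → ℤ)) (hB : B.Finite) :
    ∃ (m : ℕ) (S : Fin m → Set (Fin 3 → ℝ)),
      (∀ i, (S i).Finite) ∧
      Nonempty (ContinuousMap.HomotopyEquiv ↥(⋃ i, convexHull ℝ (S i)) ↥(contAnalog B)) ∧
      Is2Manifold (frontier (⋃ i, convexHull ℝ (S i))) := by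
  obtain ⟨m, b, -, rfl⟩ := hB.fin_param
  have hU : ⋃ i, convexHull ℝ (cubeVertices (b i) (3 / 4)) = cubeUnion (range b) (3 / 4) := by
    rw [cubeUnion, biUnion_range]
    exact iUnion_congr fun i => convexHull_cubeVertices _ (by norm_num)
  refine ⟨m, fun i => cubeVertices (b i) (3 / 4), fun i => finite_cubeVertices _ _, ?_⟩
  rw [hU]
  exact ⟨nonempty_homotopyEquiv_contAnalog _,
    is2Manifold_frontier (isClosed_cubeUnion hB _) (locallyMonotoneAt_cubeUnion _)⟩
end

section
/- Let K be a simplicial complex in ℝ³ with finitely many faces such that: (a) K is pure 2-dimensional, i.e. every face of K is contained in a face with exactly 3 vertices; (b) every face with exactly 2 vertices (edge) is contained in exactly two faces with 3 vertices (triangles); and (c) for every vertex v of K, the realization of the link of v, namely ⋃ { convexHull(s) : s a face of K, v ∉ s, s ∪ {v} a face of K }, is a connected nonempty set. Then the underlying space of K, ⋃ { convexHull(s) : s a face of K }, is a topological 2-manifold. (Simplicial version of the proposition: a 2-dimensional complex in which every edge has exactly two 2-cofaces and every vertex has connected link is a 2-manifold.) -/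
open scoped Classical

theorem SimpleGraph.exists_cyclic_labelling {V : Type*} [Finite V] (G : SimpleGraph V)
    (hconn : G.Connected) (hdeg : ∀ v, (G.neighborSet v).ncard = 2) :
    ∃ n : ℕ, 3 ≤ n ∧ ∃ w : ZMod n → V, Function.Bijective w ∧
      (∀ k, G.Adj (w k) (w (k + 1))) ∧
      ∀ k b, G.Adj (w k) b → b = w (k + 1) ∨ b = w (k - 1) := by
  obtain ⟨v⟩ := hconn.nonempty
  have hne (u : V) : (G.neighborSet u).Nonempty :=
    Set.nonempty_of_ncard_ne_zero (by rw [hdeg]; norm_num)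
  have hcyc : G.IsCycles := fun u _ => hdeg u
  obtain ⟨p, hp, hverts⟩ := hcyc.exists_cycle_toSubgraph_verts_eq_connectedComponentSupp
    (c := G.connectedComponentMk v) (v := v) rfl (hne v)
  have hn := hp.three_le_length
  have : NeZero p.length := ⟨by omega⟩
  have : Fact (1 < p.length) := ⟨by omega⟩
  have hsucc (k : ZMod p.length) : p.getVert (k + 1).val = p.getVert (k.val + 1) := by
    rw [ZMod.val_add, ZMod.val_one]
    have := k.val_lt
    rcases eq_or_lt_of_le (Nat.succ_le_of_lt this) with h | h
    · rw [← Nat.succ_eq_add_one, h, Nat.mod_self, p.getVert_zero, p.getVert_length]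
    · rw [Nat.mod_eq_of_lt h]
  have hinj : Function.Injective fun k : ZMod p.length => p.getVert k.val := fun a b hab =>
    ZMod.val_injective _ (hp.getVert_injOn' (by have := a.val_lt; simp; omega)
      (by have := b.val_lt; simp; omega) hab)
  have hadj (k : ZMod p.length) : G.Adj (p.getVert k.val) (p.getVert (k + 1).val) := by
    rw [hsucc]
    exact p.adj_getVert_succ k.val_lt
  refine ⟨p.length, hn, fun k => p.getVert k.val, ⟨hinj, fun u => ?_⟩, hadj, fun k b hb => ?_⟩
  · have hu : u ∈ p.toSubgraph.verts := by
      rw [hverts, SimpleGraph.ConnectedComponent.mem_supp_iff, SimpleGraph.ConnectedComponent.eq]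
      exact hconn.preconnected u v
    rw [SimpleGraph.Walk.mem_verts_toSubgraph,
      SimpleGraph.Walk.mem_support_iff_exists_getVert] at hu
    obtain ⟨m, rfl, hm⟩ := hu
    rcases hm.eq_or_lt with h | h
    · exact ⟨0, by simp [h]⟩
    · exact ⟨m, by simp [ZMod.val_natCast, Nat.mod_eq_of_lt h]⟩
  · have hprev : G.Adj (p.getVert k.val) (p.getVert (k - 1).val) := by
      have := hadj (k - 1)
      rw [sub_add_cancel] at this
      exact this.symm
    have hdist : p.getVert (k + 1).val ≠ p.getVert (k - 1).val := by
      intro h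
      have h2 : k + 1 = k - 1 := hinj h
      have h3 : (2 : ZMod p.length) = 0 := by linear_combination h2
      have h4 : ((2 : ℕ) : ZMod p.length) = 0 := by exact_mod_cast h3
      rw [ZMod.natCast_eq_zero_iff] at h4
      have := Nat.le_of_dvd (by norm_num) h4
      omega
    have hsub : {p.getVert (k + 1).val, p.getVert (k - 1).val} ⊆ G.neighborSet (p.getVert k.val) := by
      rintro x (rfl | rfl)
      exacts [hadj k, hprev]
    have heq := Set.eq_of_subset_of_ncard_le hsub (by rw [hdeg, Set.ncard_pair hdist])
    have hb' : b ∈ G.neighborSet (p.getVert k.val) := hb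
    rw [← heq] at hb'
    exact hb'

/-- The hat function of the `i`-th of `n` equally spaced points of the circle. -/
noncomputable def circleHat (n : ℕ) [NeZero n] (i : ZMod n) (t : UnitAddCircle) : ℝ :=
  max 0 (1 - n * ‖t - ZMod.toAddCircle i‖)

section circleHat

variable {n : ℕ} [NeZero n]

theorem continuous_circleHat (i : ZMod n) : Continuous (circleHat n i) := by
  unfold circleHat
  fun_prop

theorem circleHat_nonneg (i : ZMod n) (t : UnitAddCircle) : 0 ≤ circleHat n i t :=
  le_max_left _ _

theorem circleHat_le_one (i : ZMod n) (t : UnitAddCircle) : circleHat n i t ≤ 1 :=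
  max_le zero_le_one (by have : 0 ≤ n * ‖t - ZMod.toAddCircle i‖ := by positivity
                         linarith)

/-- The point at parameter `s ∈ [0, 1]` of the arc from the `k`-th to the `(k + 1)`-st of `n` equally
spaced points of the circle. -/
noncomputable def arcPoint (n : ℕ) [NeZero n] (k : ZMod n) (s : ℝ) : UnitAddCircle :=
  ZMod.toAddCircle k + ((s / n : ℝ) : UnitAddCircle)

theorem exists_arcPoint (t : UnitAddCircle) :
    ∃ (k : ZMod n) (s : ℝ), 0 ≤ s ∧ s ≤ 1 ∧ t = arcPoint n k s := by
  have hn : (0 : ℝ) < n := by exact_mod_cast NeZero.pos n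
  induction t using QuotientAddGroup.induction_on with | H x
  refine ⟨(⌊n * x⌋ : ℤ), Int.fract (n * x), Int.fract_nonneg _, (Int.fract_lt_one _).le, ?_⟩
  rw [arcPoint, ZMod.toAddCircle_intCast, ← AddCircle.coe_add]
  congr 1
  rw [← add_div, Int.floor_add_fract]
  field_simp

theorem one_le_mul_norm_coe {x : ℝ} (h1 : 1 ≤ n * x) (h2 : n * x ≤ n - 1) :
    1 ≤ n * ‖(x : UnitAddCircle)‖ := by
  have hn : (0 : ℝ) < n := by exact_mod_cast NeZero.pos n
  rw [UnitAddCircle.norm_eq, ← abs_of_pos hn, ← abs_mul, mul_sub]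
  rcases le_or_gt (round x) 0 with h | h
  · have : (round x : ℝ) ≤ 0 := by exact_mod_cast h
    rw [le_abs]; left; nlinarith
  · have : (1 : ℝ) ≤ round x := by exact_mod_cast h
    rw [le_abs]; right; nlinarith

theorem circleHat_arcPoint (k i : ZMod n) (s : ℝ) :
    circleHat n i (arcPoint n k s) =
      max 0 (1 - n * ‖((((k - i).val + s) / n : ℝ) : UnitAddCircle)‖) := by
  rw [circleHat, arcPoint, add_sub_right_comm, ← map_sub, ZMod.toAddCircle_apply,
    ← AddCircle.coe_add, add_div]

theorem circleHat_arcPoint_self (hn : 3 ≤ n) (k : ZMod n) {s : ℝ} (h0 : 0 ≤ s) (h1 : s ≤ 1) :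
    circleHat n k (arcPoint n k s) = 1 - s := by
  have hn' : (3 : ℝ) ≤ n := by exact_mod_cast hn
  have : ‖((s / n : ℝ) : UnitAddCircle)‖ = |s / n| := by
    rw [AddCircle.norm_coe_eq_abs_iff _ one_ne_zero, abs_of_nonneg (by positivity), abs_one,
      div_le_div_iff₀ (by linarith) (by norm_num)]
    linarith
  rw [circleHat_arcPoint, sub_self, ZMod.val_zero, Nat.cast_zero, zero_add, this,
    abs_of_nonneg (by positivity), mul_div_cancel₀ _ (by positivity), max_eq_right (by linarith)]

theorem circleHat_arcPoint_succ (hn : 3 ≤ n) (k : ZMod n) {s : ℝ} (h0 : 0 ≤ s) (h1 : s ≤ 1) :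
    circleHat n (k + 1) (arcPoint n k s) = s := by
  have hn' : (3 : ℝ) ≤ n := by exact_mod_cast hn
  have : ‖(((s - 1) / n : ℝ) : UnitAddCircle)‖ = |(s - 1) / n| := by
    rw [AddCircle.norm_coe_eq_abs_iff _ one_ne_zero, abs_div, abs_one,
      abs_of_nonneg (by positivity : (0 : ℝ) ≤ n), abs_of_nonpos (by linarith),
      div_le_div_iff₀ (by linarith) (by norm_num)]
    linarith
  have hpt : arcPoint n k s - ZMod.toAddCircle (k + 1) = (((s - 1) / n : ℝ) : UnitAddCircle) := by
    have h : ZMod.toAddCircle (1 : ZMod n) = ((1 / n : ℝ) : UnitAddCircle) := by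
      simpa using ZMod.toAddCircle_intCast (N := n) 1
    rw [arcPoint, map_add, add_sub_add_left_eq_sub, h, ← AddCircle.coe_sub, sub_div]
  rw [circleHat, hpt, this, abs_div, abs_of_nonneg (by positivity : (0 : ℝ) ≤ n),
    abs_of_nonpos (by linarith), mul_div_cancel₀ _ (by positivity), max_eq_right (by linarith)]
  ring

theorem circleHat_arcPoint_of_ne {k i : ZMod n} (hi : i ≠ k) (hi' : i ≠ k + 1)
    {s : ℝ} (h0 : 0 ≤ s) (h1 : s ≤ 1) : circleHat n i (arcPoint n k s) = 0 := by
  have hn : (0 : ℝ) < n := by exact_mod_cast NeZero.pos n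
  have hpos : 1 ≤ (k - i).val := by
    rw [Nat.one_le_iff_ne_zero, Ne, ZMod.val_eq_zero, sub_eq_zero]
    exact hi.symm
  have hlt : (k - i).val + 2 ≤ n := by
    by_contra h
    have h2 : (k - i).val + 1 = n := by have := (k - i).val_lt; omega
    apply hi'
    have h3 : (((k - i).val + 1 : ℕ) : ZMod n) = 0 := by rw [h2]; simp
    rw [Nat.cast_add, ZMod.natCast_zmod_val] at h3
    push_cast at h3
    linear_combination -h3
  have hpos' : (1 : ℝ) ≤ (k - i).val := by exact_mod_cast hpos
  have hlt' : ((k - i).val : ℝ) + 2 ≤ n := by exact_mod_cast hlt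
  rw [circleHat_arcPoint, max_eq_left]
  have := one_le_mul_norm_coe (n := n) (x := ((k - i).val + s) / n)
    (by rw [mul_div_cancel₀ _ hn.ne']; linarith) (by rw [mul_div_cancel₀ _ hn.ne']; linarith)
  linarith

theorem sum_circleHat_smul_arcPoint {E : Type*} [AddCommGroup E] [Module ℝ E] (hn : 3 ≤ n)
    (w : ZMod n → E) (k : ZMod n) {s : ℝ} (h0 : 0 ≤ s) (h1 : s ≤ 1) :
    ∑ i, circleHat n i (arcPoint n k s) • w i = (1 - s) • w k + s • w (k + 1) := by
  have : Fact (1 < n) := ⟨by omega⟩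
  have hk : k ≠ k + 1 := by simp
  rw [Fintype.sum_eq_add k (k + 1) hk, circleHat_arcPoint_self hn k h0 h1,
    circleHat_arcPoint_succ hn k h0 h1]
  rintro i ⟨hi, hi'⟩
  rw [circleHat_arcPoint_of_ne hi hi' h0 h1, zero_smul]

theorem sum_circleHat (hn : 3 ≤ n) (t : UnitAddCircle) : ∑ i, circleHat n i t = 1 := by
  obtain ⟨k, s, h0, h1, rfl⟩ := exists_arcPoint (n := n) t
  simpa using sum_circleHat_smul_arcPoint hn (fun _ => (1 : ℝ)) k h0 h1

theorem circleHat_eq_one_iff (i : ZMod n) (t : UnitAddCircle) :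
    circleHat n i t = 1 ↔ t = ZMod.toAddCircle i := by
  have hn : (n : ℝ) ≠ 0 := by exact_mod_cast NeZero.ne n
  constructor
  · intro h
    rw [circleHat] at h
    have : 1 - n * ‖t - ZMod.toAddCircle i‖ = 1 := by
      rcases max_choice 0 (1 - n * ‖t - ZMod.toAddCircle i‖) with h' | h' <;> linarith
    have h3 : n * ‖t - ZMod.toAddCircle i‖ = 0 := by linarith
    simpa [hn, sub_eq_zero] using h3
  · rintro rfl
    simp [circleHat]

theorem circleHat_injective (hn : 3 ≤ n) {t t' : UnitAddCircle}
    (h : ∀ i, circleHat n i t = circleHat n i t') : t = t' := by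
  have : Fact (1 < n) := ⟨by omega⟩
  obtain ⟨k, s, h0, h1, rfl⟩ := exists_arcPoint (n := n) t
  obtain ⟨k', s', h0', h1', rfl⟩ := exists_arcPoint (n := n) t'
  have hk := h k
  have hk1 := h (k + 1)
  rw [circleHat_arcPoint_self hn k h0 h1] at hk
  rw [circleHat_arcPoint_succ hn k h0 h1] at hk1
  by_cases hs0 : s = 0
  · have h2 := (circleHat_eq_one_iff k (arcPoint n k' s')).1 (by linarith)
    rw [h2, hs0]; simp [arcPoint]
  by_cases hs1 : s = 1
  · have h2 := (circleHat_eq_one_iff (k + 1) (arcPoint n k' s')).1 (by linarith)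
    have h3 := (circleHat_eq_one_iff (k + 1) (arcPoint n k s)).1
      (by rw [circleHat_arcPoint_succ hn k h0 h1, hs1])
    rw [h2, h3]
  have hmem (i : ZMod n) (hi : circleHat n i (arcPoint n k' s') ≠ 0) : i = k' ∨ i = k' + 1 := by
    by_contra! hcon
    exact hi (circleHat_arcPoint_of_ne hcon.1 hcon.2 h0' h1')
  have h1s : 1 - s ≠ 0 := fun h => hs1 (by linarith)
  obtain rfl : k = k' := by
    rcases hmem k (hk ▸ h1s) with hkk | hkk
    · exact hkk
    rcases hmem (k + 1) (hk1 ▸ hs0) with hkk' | hkk'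
    · exfalso
      have h3 : ((2 : ℕ) : ZMod n) = 0 := by
        push_cast
        linear_combination hkk' - hkk
      rw [ZMod.natCast_eq_zero_iff] at h3
      have := Nat.le_of_dvd (by norm_num) h3
      omega
    · simpa using hkk'
  rw [circleHat_arcPoint_self hn k h0' h1'] at hk
  rw [show s = s' by linarith]

end circleHat

open scoped Real in
/-- The argument of a complex number as a point of the circle of length one. -/
noncomputable def unitArg (z : ℂ) : UnitAddCircle :=
  AddCircle.homeomorphAddCircle (2 * π) 1 Real.two_pi_pos.ne' one_ne_zero (Complex.arg z : Real.Angle)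

theorem continuousAt_unitArg {z : ℂ} (hz : z ≠ 0) : ContinuousAt unitArg z :=
  (Homeomorph.continuous _).continuousAt.comp (Complex.continuousAt_arg_coe_angle hz)

theorem eq_of_norm_eq_of_unitArg_eq {z z' : ℂ} (h : ‖z‖ = ‖z'‖) (h' : unitArg z = unitArg z') :
    z = z' :=
  Complex.ext_norm_arg h (Complex.arg_coe_angle_eq_iff.1 ((Homeomorph.injective _) h'))

theorem exists_norm_eq_unitArg_eq {r : ℝ} (hr : 0 < r) (t : UnitAddCircle) :
    ∃ z : ℂ, ‖z‖ = r ∧ unitArg z = t := by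
  obtain ⟨θ, rfl⟩ := (AddCircle.homeomorphAddCircle (2 * Real.pi) 1 Real.two_pi_pos.ne'
    one_ne_zero).surjective t
  let φ : Real.Angle := θ
  refine ⟨r * (φ.cos + φ.sin * Complex.I), ?_, ?_⟩
  · induction φ using Real.Angle.induction_on with | _ x
    rw [Real.Angle.cos_coe, Real.Angle.sin_coe, norm_mul, Complex.ofReal_cos, Complex.ofReal_sin,
      Complex.norm_cos_add_sin_mul_I]
    simp [abs_of_pos hr]
  · rw [unitArg, Complex.arg_mul_cos_add_sin_mul_I_coe_angle hr]

/-- The `i`-th barycentric coordinate, with respect to the vertices of a regular `n`-gon, of a point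
of the unit disc regarded as the cone on the unit circle. -/
noncomputable def coneCoord (n : ℕ) [NeZero n] (i : ZMod n) (z : ℂ) : ℝ :=
  ‖z‖ * circleHat n i (unitArg z)

section coneCoord

variable {n : ℕ} [NeZero n]

theorem coneCoord_nonneg (i : ZMod n) (z : ℂ) : 0 ≤ coneCoord n i z :=
  mul_nonneg (norm_nonneg _) (circleHat_nonneg _ _)

theorem continuous_coneCoord (i : ZMod n) : Continuous (coneCoord n i) := by
  rw [continuous_iff_continuousAt]
  intro z
  rcases eq_or_ne z 0 with rfl | hz
  · have h0 : coneCoord n i 0 = 0 := by simp [coneCoord]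
    rw [ContinuousAt, h0]
    refine squeeze_zero (coneCoord_nonneg i) (fun z => ?_) (tendsto_norm_zero (E := ℂ))
    exact mul_le_of_le_one_right (norm_nonneg _) (circleHat_le_one _ _)
  · exact continuous_norm.continuousAt.mul
      ((continuous_circleHat i).continuousAt.comp (continuousAt_unitArg hz))

theorem sum_coneCoord (hn : 3 ≤ n) (z : ℂ) : ∑ i, coneCoord n i z = ‖z‖ := by
  simp_rw [coneCoord]
  rw [← Finset.mul_sum, sum_circleHat hn, mul_one]

theorem coneCoord_injective (hn : 3 ≤ n) {z z' : ℂ}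
    (h : ∀ i, coneCoord n i z = coneCoord n i z') : z = z' := by
  have hnorm : ‖z‖ = ‖z'‖ := by
    rw [← sum_coneCoord hn, ← sum_coneCoord hn]
    exact Finset.sum_congr rfl fun i _ => h i
  rcases eq_or_ne z 0 with rfl | hz
  · exact (norm_eq_zero.1 (by rw [← hnorm, norm_zero])).symm
  refine eq_of_norm_eq_of_unitArg_eq hnorm (circleHat_injective hn fun i => ?_)
  have := h i
  rw [coneCoord, coneCoord, ← hnorm] at this
  exact mul_left_cancel₀ (norm_ne_zero_iff.2 hz) this

theorem exists_coneCoord_eq_zero (z : ℂ) :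
    ∃ k, ∀ i : ZMod n, coneCoord n i z ≠ 0 → i = k ∨ i = k + 1 := by
  obtain ⟨k, s, h0, h1, hs⟩ := exists_arcPoint (n := n) (unitArg z)
  refine ⟨k, fun i hi => ?_⟩
  by_contra! h
  exact hi (by rw [coneCoord, hs, circleHat_arcPoint_of_ne h.1 h.2 h0 h1, mul_zero])

theorem exists_sum_coneCoord_smul_eq {E : Type*} [AddCommGroup E] [Module ℝ E] (hn : 3 ≤ n)
    (w : ZMod n → E) (k : ZMod n) {α β : ℝ} (hα : 0 ≤ α) (hβ : 0 ≤ β) :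
    ∃ z : ℂ, ‖z‖ = α + β ∧ ∑ i, coneCoord n i z • w i = α • w k + β • w (k + 1) := by
  rcases (add_nonneg hα hβ).eq_or_lt with h | h
  · exact ⟨0, by simpa using h, by simp [coneCoord, show α = 0 by linarith, show β = 0 by linarith]⟩
  obtain ⟨z, hz, hzt⟩ := exists_norm_eq_unitArg_eq h (arcPoint n k (β / (α + β)))
  refine ⟨z, hz, ?_⟩
  simp_rw [coneCoord, mul_smul]
  rw [← Finset.smul_sum, hzt, hz, sum_circleHat_smul_arcPoint hn w k (by positivity)
    (div_le_one_of_le₀ (by linarith) h.le), smul_add, smul_smul, smul_smul,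
    mul_div_cancel₀ _ h.ne', mul_sub, mul_div_cancel₀ _ h.ne']
  simp

end coneCoord

/-- If `f` maps the closed unit disc continuously and injectively to `E` and the open unit disc onto
`O`, and `O` is open in `S`, then every point of `O` has a planar neighbourhood in `S`. -/
theorem exists_homeomorph_of_disc {E : Type*} [TopologicalSpace E] [T2Space E] {S C : Set E}
    (hC : IsClosed C) {f : ℂ → E} (hf : Continuous f)
    (hinj : Set.InjOn f (Metric.closedBall 0 1)) (himg : f '' Metric.ball 0 1 = S \ C)
    (x : S) (hx : x.1 ∉ C) :
    ∃ (U : Set S) (V : Set (Fin 2 → ℝ)), IsOpen U ∧ IsOpen V ∧ x ∈ U ∧ Nonempty (U ≃ₜ V) := by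
  let e : (Fin 2 → ℝ) ≃ₜ ℂ :=
    Homeomorph.finTwoArrow.trans Complex.equivRealProdCLM.symm.toHomeomorph
  let U : Set S := Subtype.val ⁻¹' Cᶜ
  let V : Set (Fin 2 → ℝ) := e ⁻¹' Metric.ball 0 1
  let F : Metric.closedBall (0 : ℂ) 1 → E := fun z => f z
  have hF : Topology.IsClosedEmbedding F :=
    (hf.comp continuous_subtype_val).isClosedEmbedding
      fun a b hab => Subtype.ext (hinj a.2 b.2 hab)
  let ι : V → Metric.closedBall (0 : ℂ) 1 := fun p => ⟨e p, Metric.ball_subset_closedBall p.2⟩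
  have hι : Topology.IsEmbedding ι :=
    .of_comp (by fun_prop) continuous_subtype_val
      (e.isEmbedding.comp Topology.IsEmbedding.subtypeVal)
  have hV : Topology.IsEmbedding (F ∘ ι) := hF.isEmbedding.comp hι
  have hU : Topology.IsEmbedding (fun y : U => (y : S).1) :=
    Topology.IsEmbedding.subtypeVal.comp Topology.IsEmbedding.subtypeVal
  have hrange : Set.range (fun y : U => (y : S).1) = Set.range (F ∘ ι) := by
    have h1 : Set.range (fun y : U => (y : S).1) = S \ C := by
      ext y
      constructor
      · rintro ⟨y, rfl⟩
        exact ⟨y.1.2, y.2⟩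
      · rintro ⟨h, h'⟩
        exact ⟨⟨⟨y, h⟩, h'⟩, rfl⟩
    rw [h1, ← himg]
    ext y
    constructor
    · rintro ⟨z, hz, rfl⟩
      refine ⟨⟨e.symm z, ?_⟩, ?_⟩
      · simpa [V] using hz
      · simp [F, ι]
    · rintro ⟨p, rfl⟩
      exact ⟨e p, p.2, rfl⟩
  exact ⟨U, V, hC.isOpen_compl.preimage continuous_subtype_val,
    Metric.isOpen_ball.preimage e.continuous, hx,
    ⟨hU.toHomeomorph.trans ((Homeomorph.setCongr hrange).trans hV.toHomeomorph.symm)⟩⟩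

/-- Two families of weights on an affinely independent finite set with equal total weight and equal
weighted sums agree. -/
theorem AffineIndependent.eq_of_sum_smul_eq {E : Type*} [AddCommGroup E] [Module ℝ E]
    {s : Finset E} (hs : AffineIndependent ℝ ((↑) : s → E)) {a b : E → ℝ}
    (h1 : ∑ y ∈ s, a y = ∑ y ∈ s, b y) (h2 : ∑ y ∈ s, a y • y = ∑ y ∈ s, b y • y) :
    ∀ y ∈ s, a y = b y := by
  intro y hy
  have := (affineIndependent_iff.1 hs) Finset.univ (fun y => a y - b y)
    (by rw [Finset.sum_coe_sort s (fun y => a y - b y), Finset.sum_sub_distrib, h1, sub_self])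
    (by rw [Finset.sum_coe_sort s (fun y => (a y - b y) • y)]
        simp_rw [sub_smul]
        rw [Finset.sum_sub_distrib, h2, sub_self])
    ⟨y, hy⟩ (Finset.mem_univ _)
  exact sub_eq_zero.1 this

theorem mem_convexHull_triple {E : Type*} [AddCommGroup E] [Module ℝ E] {a b c x : E} :
    x ∈ convexHull ℝ {a, b, c} ↔ ∃ α β γ : ℝ, 0 ≤ α ∧ 0 ≤ β ∧ 0 ≤ γ ∧ α + β + γ = 1 ∧
      α • a + (β • b + γ • c) = x := by
  rw [convexHull_insert (Set.insert_nonempty _ _), mem_convexJoin]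
  simp only [Set.mem_singleton_iff, exists_eq_left, convexHull_pair]
  constructor
  · rintro ⟨y, ⟨β, γ, hβ, hγ, h, rfl⟩, δ, ε, hδ, hε, h', rfl⟩
    refine ⟨δ, ε * β, ε * γ, hδ, by positivity, by positivity, ?_, by module⟩
    linear_combination h' + ε * h
  · rintro ⟨α, β, γ, hα, hβ, hγ, h, rfl⟩
    rcases (add_nonneg hβ hγ).eq_or_lt with h0 | h0
    · obtain rfl : β = 0 := by linarith
      obtain rfl : γ = 0 := by linarith
      obtain rfl : α = 1 := by linarith
      exact ⟨b, left_mem_segment ℝ b c, by simpa using left_mem_segment ℝ a b⟩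
    · refine ⟨(β / (β + γ)) • b + (γ / (β + γ)) • c,
        ⟨β / (β + γ), γ / (β + γ), by positivity, by positivity, by field_simp, rfl⟩,
        α, β + γ, hα, h0.le, by linarith, ?_⟩
      rw [smul_add, smul_smul, smul_smul, mul_div_cancel₀ _ h0.ne', mul_div_cancel₀ _ h0.ne']

theorem Finset.sum_eq_sum_of_forall_notMem {E M : Type*} [AddCommMonoid M] {s t : Finset E}
    {f : E → M} (hs : ∀ y ∉ s, f y = 0) (ht : ∀ y ∉ t, f y = 0) :
    ∑ y ∈ s, f y = ∑ y ∈ t, f y := by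
  rw [← Finset.sum_subset Finset.inter_subset_right (s₁ := s ∩ t) (s₂ := t),
    ← Finset.sum_subset Finset.inter_subset_left (s₁ := s ∩ t) (s₂ := s)]
  · exact fun y _ hy => by by_cases y ∈ t <;> simp_all
  · exact fun y _ hy => by by_cases y ∈ s <;> simp_all

section Extend

variable {E : Type*} {ι : Type*} {p : ι → E}

theorem Function.Injective.sum_extend_eq {M : Type*} [AddCommMonoid M]
    [Fintype ι] (hp : Function.Injective p) (f : E → ℝ → M) (hf : ∀ y, f y 0 = 0) {s : Finset E} {a : ι → ℝ}
    (has : ∀ i, a i ≠ 0 → p i ∈ s) :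
    ∑ y ∈ s, f y (Function.extend p a 0 y) = ∑ i, f (p i) (a i) := by
  have h1 : ∑ i, f (p i) (a i) = ∑ y ∈ Finset.univ.image p, f y (Function.extend p a 0 y) := by
    rw [Finset.sum_image hp.injOn]
    simp_rw [hp.extend_apply]
  rw [h1, ← Finset.sum_subset Finset.inter_subset_left (s₁ := s ∩ Finset.univ.image p) (s₂ := s),
    ← Finset.sum_subset Finset.inter_subset_right (s₁ := s ∩ Finset.univ.image p)
      (s₂ := Finset.univ.image p)]
  · intro y hy hy'
    obtain ⟨i, -, rfl⟩ := Finset.mem_image.1 hy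
    rw [hp.extend_apply, show a i = 0 from ?_, hf]
    by_contra h
    exact hy' (Finset.mem_inter.2 ⟨has i h, hy⟩)
  · intro y hy hy'
    rw [Function.extend_apply', Pi.zero_apply, hf]
    rintro ⟨i, rfl⟩
    exact hy' (Finset.mem_inter.2 ⟨hy, Finset.mem_image_of_mem _ (Finset.mem_univ _)⟩)

theorem Function.Injective.extend_nonneg (hp : Function.Injective p) {a : ι → ℝ} (ha : ∀ i, 0 ≤ a i) (y : E) :
    0 ≤ Function.extend p a 0 y := by
  by_cases h : ∃ i, p i = y
  · obtain ⟨i, rfl⟩ := h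
    rw [hp.extend_apply]
    exact ha i
  · rw [Function.extend_apply' _ _ _ h, Pi.zero_apply]

theorem Function.Injective.extend_eq_zero (hp : Function.Injective p) {s : Finset E} {a : ι → ℝ}
    (has : ∀ i, a i ≠ 0 → p i ∈ s) (y : E) (hy : y ∉ s) : Function.extend p a 0 y = 0 := by
  by_cases h : ∃ i, p i = y
  · obtain ⟨i, rfl⟩ := h
    rw [hp.extend_apply]
    by_contra hi
    exact hy (has i hi)
  · rw [Function.extend_apply' _ _ _ h, Pi.zero_apply]

end Extend

namespace Geometry.SimplicialComplex

section Weights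

variable {E : Type*} [AddCommGroup E] [Module ℝ E] {K : SimplicialComplex ℝ E}

/-- Barycentric weights that are supported on the face `s` and represent a point of the face `t`
vanish off `t`. -/
theorem weight_eq_zero {s t : Finset E} (hs : s ∈ K.faces) (ht : t ∈ K.faces) {a : E → ℝ}
    (hsum : ∑ y ∈ s, a y = 1) (ha : ∀ y ∈ s, 0 ≤ a y)
    (hmem : ∑ y ∈ s, a y • y ∈ convexHull ℝ (t : Set E)) {y : E} (hy : y ∈ s) (hyt : y ∉ t) :
    a y = 0 := by
  have hmem_s : ∑ y ∈ s, a y • y ∈ convexHull ℝ (s : Set E) :=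
    Finset.mem_convexHull'.2 ⟨a, ha, hsum, rfl⟩
  have hmem_st := K.inter_subset_convexHull hs ht ⟨hmem_s, hmem⟩
  rw [← Finset.coe_inter, Finset.mem_convexHull'] at hmem_st
  obtain ⟨c, -, hc, hc'⟩ := hmem_st
  have key := (K.indep hs).eq_of_sum_smul_eq (a := a) (b := fun y => if y ∈ t then c y else 0)
    (by rw [hsum, ← hc, ← Finset.sum_filter, Finset.filter_mem_eq_inter])
    (by simp_rw [ite_smul, zero_smul]
        rw [← hc', ← Finset.sum_filter, Finset.filter_mem_eq_inter]) y hy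
  rwa [if_neg hyt] at key

/-- Points of a simplicial complex have unique barycentric coordinates. -/
theorem weight_unique {s t : Finset E} (hs : s ∈ K.faces) (ht : t ∈ K.faces) {a b : E → ℝ}
    (ha : ∀ y, 0 ≤ a y) (hb : ∀ y, 0 ≤ b y) (has : ∀ y ∉ s, a y = 0) (hbt : ∀ y ∉ t, b y = 0)
    (ha1 : ∑ y ∈ s, a y = 1) (hb1 : ∑ y ∈ t, b y = 1)
    (hab : ∑ y ∈ s, a y • y = ∑ y ∈ t, b y • y) : a = b := by
  have hat (y) (hy : y ∉ t) : a y = 0 := by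
    by_cases hys : y ∈ s
    · exact weight_eq_zero hs ht ha1 (fun y _ => ha y)
        (hab ▸ Finset.mem_convexHull'.2 ⟨b, fun y _ => hb y, hb1, rfl⟩) hys hy
    · exact has y hys
  have hbs (y) (hy : y ∉ s) : b y = 0 := by
    by_cases hyt : y ∈ t
    · exact weight_eq_zero ht hs hb1 (fun y _ => hb y)
        (hab ▸ Finset.mem_convexHull'.2 ⟨a, fun y _ => ha y, ha1, rfl⟩) hyt hy
    · exact hbt y hyt
  rw [Finset.sum_eq_sum_of_forall_notMem hbt hbs] at hb1
  rw [Finset.sum_eq_sum_of_forall_notMem (f := fun y => b y • y)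
    (fun y hy => by simp [hbt y hy]) (fun y hy => by simp [hbs y hy])] at hab
  funext y
  by_cases hy : y ∈ s
  · exact (K.indep hs).eq_of_sum_smul_eq (ha1.trans hb1.symm) hab y hy
  · rw [has y hy, hbs y hy]

variable {ι : Type*} [Fintype ι] {p : ι → E}

theorem family_weight_unique (hp : Function.Injective p) {s t : Finset E} (hs : s ∈ K.faces)
    (ht : t ∈ K.faces) {a b : ι → ℝ} (ha : ∀ i, 0 ≤ a i) (hb : ∀ i, 0 ≤ b i)
    (has : ∀ i, a i ≠ 0 → p i ∈ s) (hbt : ∀ i, b i ≠ 0 → p i ∈ t)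
    (ha1 : ∑ i, a i = 1) (hb1 : ∑ i, b i = 1) (hab : ∑ i, a i • p i = ∑ i, b i • p i) :
    a = b := by
  have key : Function.extend p a 0 = Function.extend p b 0 :=
    weight_unique hs ht (hp.extend_nonneg ha) (hp.extend_nonneg hb)
      (hp.extend_eq_zero has) (hp.extend_eq_zero hbt)
      ((hp.sum_extend_eq (fun _ r => r) (fun _ => rfl) has).trans ha1)
      ((hp.sum_extend_eq (fun _ r => r) (fun _ => rfl) hbt).trans hb1)
      ((hp.sum_extend_eq (fun y r => r • y) (fun _ => zero_smul _ _) has).trans <| hab.trans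
        (hp.sum_extend_eq (fun y r => r • y) (fun _ => zero_smul _ _) hbt).symm)
  funext i
  rw [← hp.extend_apply a 0 i, key, hp.extend_apply]

theorem family_sum_mem_convexHull (hp : Function.Injective p) {s : Finset E} {a : ι → ℝ}
    (ha : ∀ i, 0 ≤ a i) (has : ∀ i, a i ≠ 0 → p i ∈ s) (ha1 : ∑ i, a i = 1) :
    ∑ i, a i • p i ∈ convexHull ℝ (s : Set E) :=
  Finset.mem_convexHull'.2 ⟨Function.extend p a 0, fun y _ => hp.extend_nonneg ha y,
    (hp.sum_extend_eq (fun _ r => r) (fun _ => rfl) has).trans ha1,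
    hp.sum_extend_eq (fun y r => r • y) (fun _ => zero_smul _ _) has⟩

theorem family_weight_eq_zero (hp : Function.Injective p) {s t : Finset E} (hs : s ∈ K.faces)
    (ht : t ∈ K.faces) {a : ι → ℝ} (ha : ∀ i, 0 ≤ a i) (has : ∀ i, a i ≠ 0 → p i ∈ s)
    (ha1 : ∑ i, a i = 1) (hmem : ∑ i, a i • p i ∈ convexHull ℝ (t : Set E)) {i : ι}
    (hi : p i ∉ t) : a i = 0 := by
  by_contra h
  refine h ?_
  rw [← hp.extend_apply a 0 i]
  refine weight_eq_zero hs ht (hp.sum_extend_eq (fun _ r => r) (fun _ => rfl) has |>.trans ha1)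
    (fun y _ => hp.extend_nonneg ha y) ?_ (has i h) hi
  rwa [hp.sum_extend_eq (fun y r => r • y) (fun _ => zero_smul _ _) has]

end Weights

end Geometry.SimplicialComplex

namespace Geometry.SimplicialComplex

section Star

variable {E : Type*} [AddCommGroup E] [Module ℝ E] {K : SimplicialComplex ℝ E}

theorem exists_forall_mem_of_mem_space {x : E} (hx : x ∈ K.space) :
    ∃ v, {v} ∈ K.faces ∧ ∀ t ∈ K.faces, x ∈ convexHull ℝ (t : Set E) → v ∈ t := by
  obtain ⟨s, ⟨hs, hxs⟩, hmin⟩ := (measure Finset.card).wf.has_min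
    {s | s ∈ K.faces ∧ x ∈ convexHull ℝ (s : Set E)} (mem_space_iff.1 hx)
  obtain ⟨v, hv⟩ := nonempty_of_mem_faces hs
  refine ⟨v, K.down_closed hs (by simpa using hv) (Finset.singleton_nonempty v), fun t ht hxt => ?_⟩
  by_contra hvt
  have hxst := K.inter_subset_convexHull hs ht ⟨hxs, hxt⟩
  rw [← Finset.coe_inter] at hxst
  have hne : (s ∩ t).Nonempty := Finset.coe_nonempty.1 (convexHull_nonempty_iff.1 ⟨x, hxst⟩)
  refine hmin (s ∩ t) ⟨K.down_closed hs Finset.inter_subset_left hne, hxst⟩ ?_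
  exact Finset.card_lt_card ⟨Finset.inter_subset_left,
    fun h => hvt (Finset.mem_inter.1 (h hv)).2⟩

variable [TopologicalSpace E] [IsTopologicalAddGroup E] [ContinuousSMul ℝ E] [T2Space E]

/-- If the link of `v` is a polygon, then the points of the open star of `v` have planar
neighbourhoods. -/
theorem exists_homeomorph_of_mem_star (hK : K.faces.Finite) {n : ℕ} [NeZero n] (hn : 3 ≤ n) {v : E}
    {w : ZMod n → E} (hw : Function.Injective w) (hwv : ∀ k, w k ≠ v)
    (hface : ∀ k, {v, w k, w (k + 1)} ∈ K.faces)
    (hstar : ∀ s ∈ K.faces, v ∈ s → ∃ k, s ⊆ {v, w k, w (k + 1)}) (x : K.space)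
    (hx : ∀ t ∈ K.faces, x.1 ∈ convexHull ℝ (t : Set E) → v ∈ t) :
    ∃ (U : Set K.space) (V : Set (Fin 2 → ℝ)),
      IsOpen U ∧ IsOpen V ∧ x ∈ U ∧ Nonempty (U ≃ₜ V) := by
  let C : Set E := ⋃ s ∈ {s | s ∈ K.faces ∧ v ∉ s}, convexHull ℝ (s : Set E)
  have hC : IsClosed C := (hK.subset fun s hs => hs.1).isClosed_biUnion
    fun s _ => s.finite_toSet.isClosed_convexHull ℝ
  let p : Option (ZMod n) → E := fun o => o.elim v w
  have hp : Function.Injective p := by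
    rintro (_ | i) (_ | j) h
    · rfl
    · exact (hwv j h.symm).elim
    · exact (hwv i h).elim
    · exact congrArg some (hw h)
  let a : ℂ → Option (ZMod n) → ℝ := fun z o => o.elim (1 - ‖z‖) fun i => coneCoord n i z
  let f : ℂ → E := fun z => ∑ o, a z o • p o
  have hf_eq (z : ℂ) : f z = (1 - ‖z‖) • v + ∑ i, coneCoord n i z • w i :=
    Fintype.sum_option _
  have hf : Continuous f := by
    rw [funext hf_eq]
    have := fun i => continuous_coneCoord (n := n) i
    fun_prop
  have ha_nonneg {z : ℂ} (hz : ‖z‖ ≤ 1) : ∀ o, 0 ≤ a z o := by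
    rintro (_ | i)
    · exact sub_nonneg.2 hz
    · exact coneCoord_nonneg i z
  have ha_sum (z : ℂ) : ∑ o, a z o = 1 := by
    rw [Fintype.sum_option]
    change 1 - ‖z‖ + ∑ i, coneCoord n i z = 1
    rw [sum_coneCoord hn]
    ring
  have ha_supp (z : ℂ) : ∃ s ∈ K.faces, ∀ o, a z o ≠ 0 → p o ∈ s := by
    obtain ⟨k, hk⟩ := exists_coneCoord_eq_zero (n := n) z
    refine ⟨_, hface k, ?_⟩
    rintro (_ | i) ho
    · simp [p]
    · rcases hk i ho with rfl | rfl <;> simp [p]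
  refine exists_homeomorph_of_disc hC hf ?_ ?_ x ?_
  · intro z hz z' hz' h
    rw [mem_closedBall_zero_iff] at hz hz'
    obtain ⟨s, hs, hsz⟩ := ha_supp z
    obtain ⟨t, ht, htz⟩ := ha_supp z'
    have := family_weight_unique hp hs ht (ha_nonneg hz) (ha_nonneg hz') hsz htz
      (ha_sum z) (ha_sum z') h
    exact coneCoord_injective hn fun i => congrFun this (some i)
  · apply Set.Subset.antisymm
    · rintro _ ⟨z, hz, rfl⟩
      rw [mem_ball_zero_iff] at hz
      obtain ⟨s, hs, hsz⟩ := ha_supp z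
      refine ⟨mem_space_iff.2 ⟨s, hs,
        family_sum_mem_convexHull hp (ha_nonneg hz.le) hsz (ha_sum z)⟩, fun hmem => ?_⟩
      obtain ⟨t, ⟨ht, hvt⟩, hmem⟩ := Set.mem_iUnion₂.1 hmem
      have h0 : 1 - ‖z‖ = 0 := family_weight_eq_zero (i := none) hp hs ht (ha_nonneg hz.le) hsz
        (ha_sum z) hmem hvt
      linarith
    · rintro y ⟨hy, hyC⟩
      obtain ⟨s, hs, hys⟩ := mem_space_iff.1 hy
      have hyC' (t) (ht : t ∈ K.faces) (hyt : y ∈ convexHull ℝ (t : Set E)) : v ∈ t := by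
        by_contra hvt
        exact hyC (Set.mem_iUnion₂.2 ⟨t, ⟨ht, hvt⟩, hyt⟩)
      obtain ⟨k, hk⟩ := hstar s hs (hyC' s hs hys)
      have hyk := convexHull_mono (𝕜 := ℝ) (Finset.coe_subset.2 hk) hys
      push_cast at hyk
      obtain ⟨α, β, γ, hα, hβ, hγ, h1, rfl⟩ := mem_convexHull_triple.1 hyk
      obtain ⟨z, hz, hzw⟩ := exists_sum_coneCoord_smul_eq hn w k hβ hγ
      refine ⟨z, ?_, ?_⟩
      · rw [mem_ball_zero_iff, hz]
        by_contra hlt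
        obtain rfl : α = 0 := by linarith
        have hedge : {w k, w (k + 1)} ∈ K.faces :=
          K.down_closed (hface k) (Finset.subset_insert _ _) (Finset.insert_nonempty _ _)
        have hv := hyC' _ hedge (by
          push_cast
          rw [convexHull_pair]
          exact ⟨β, γ, hβ, hγ, by linarith, by simp⟩)
        rw [Finset.mem_insert, Finset.mem_singleton] at hv
        rcases hv with hv | hv
        · exact hwv _ hv.symm
        · exact hwv _ hv.symm
      · rw [hf_eq, hzw, hz]
        congr 2
        linarith
  · intro hxC
    obtain ⟨t, ⟨ht, hvt⟩, hmem⟩ := Set.mem_iUnion₂.1 hxC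
    exact hvt (hx t ht hmem)

end Star

end Geometry.SimplicialComplex

namespace Geometry.SimplicialComplex

section LinkGraph

variable {E : Type*} [AddCommGroup E] [Module ℝ E]

/-- The graph formed by the edges of the link of `v`. -/
def linkGraph (K : SimplicialComplex ℝ E) (v : E) :
    SimpleGraph {y : E // y ≠ v ∧ {v, y} ∈ K.faces} where
  Adj a b := a ≠ b ∧ {v, a.1, b.1} ∈ K.faces
  symm := ⟨fun a b h => ⟨h.1.symm, by rw [Finset.pair_comm]; exact h.2⟩⟩
  loopless := ⟨fun a h => h.1 rfl⟩

variable {K : SimplicialComplex ℝ E} {v : E}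

theorem finite_linkGraph_vertices (hK : K.faces.Finite) :
    Finite {y : E // y ≠ v ∧ {v, y} ∈ K.faces} := by
  refine ((hK.biUnion fun s _ => s.finite_toSet).subset fun y hy => ?_ :
    {y : E | y ≠ v ∧ {v, y} ∈ K.faces}.Finite)
  exact Set.mem_iUnion₂.2 ⟨_, hy.2, by simp⟩

theorem mem_linkGraph_vertices {s : Finset E} (hs : s ∈ K.faces) (hv : v ∈ s) {y : E} (hy : y ∈ s)
    (hyv : y ≠ v) : y ≠ v ∧ {v, y} ∈ K.faces :=
  ⟨hyv, K.down_closed hs (by simp [Finset.insert_subset_iff, hv, hy]) (Finset.insert_nonempty _ _)⟩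

theorem ncard_linkGraph_neighborSet
    (hedge : ∀ s ∈ K.faces, s.card = 2 → {t | t ∈ K.faces ∧ t.card = 3 ∧ s ⊆ t}.ncard = 2)
    (a : {y : E // y ≠ v ∧ {v, y} ∈ K.faces}) : ((K.linkGraph v).neighborSet a).ncard = 2 := by
  have hva : v ≠ a.1 := a.2.1.symm
  rw [← hedge {v, a.1} a.2.2 (Finset.card_pair hva)]
  refine Set.ncard_congr (fun b _ => {v, a.1, b.1}) ?_ ?_ ?_
  · rintro b ⟨hab, hb⟩
    refine ⟨hb, ?_, by simp [Finset.insert_subset_iff]⟩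
    exact Finset.card_eq_three.2 ⟨v, a, b, hva, b.2.1.symm, fun h => hab (Subtype.ext h), rfl⟩
  · rintro b c ⟨hab, -⟩ - hbc
    have hb : b.1 ∈ ({v, a.1, c.1} : Finset E) := by rw [← hbc]; simp
    simp only [Finset.mem_insert, Finset.mem_singleton] at hb
    rcases hb with h | h | h
    · exact (b.2.1 h).elim
    · exact (hab (Subtype.ext h.symm)).elim
    · exact Subtype.ext h
  · rintro t ⟨ht, hcard, hsub⟩
    obtain ⟨b, hbt⟩ := Finset.card_eq_one.1 (show (t \ {v, a.1}).card = 1 by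
      rw [Finset.card_sdiff_of_subset hsub, hcard, Finset.card_pair hva])
    have hb : b ∈ t \ {v, a.1} := by rw [hbt]; simp
    simp only [Finset.mem_sdiff, Finset.mem_insert, Finset.mem_singleton, not_or] at hb
    have hv : v ∈ t := hsub (by simp)
    have ht_eq : {v, a.1, b} = t := by
      apply Finset.eq_of_subset_of_card_le
      · simp [Finset.insert_subset_iff, hv, hb.1, hsub (show a.1 ∈ ({v, a.1} : Finset E) by simp)]
      · rw [hcard, Finset.card_eq_three.2 ⟨v, a.1, b, hva, Ne.symm hb.2.1, Ne.symm hb.2.2, rfl⟩]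
    exact ⟨⟨b, mem_linkGraph_vertices ht hv hb.1 hb.2.1⟩,
      ⟨fun h => hb.2.2 (congrArg Subtype.val h).symm, ht_eq ▸ ht⟩, ht_eq⟩

theorem linkGraph_connected [TopologicalSpace E] [IsTopologicalAddGroup E] [ContinuousSMul ℝ E]
    [T2Space E] (hK : K.faces.Finite)
    (hlink : IsConnected (⋃ s ∈ {s | s ∈ K.faces ∧ v ∉ s ∧ insert v s ∈ K.faces},
      convexHull ℝ (s : Set E))) : (K.linkGraph v).Connected := by
  have hvert {s : Finset E} (hs : v ∉ s ∧ insert v s ∈ K.faces) {y : E} (hy : y ∈ s) :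
      y ≠ v ∧ {v, y} ∈ K.faces :=
    mem_linkGraph_vertices hs.2 (Finset.mem_insert_self _ _) (Finset.mem_insert_of_mem hy)
      fun h => hs.1 (h ▸ hy)
  obtain ⟨⟨x, hx⟩, hpre⟩ := hlink
  obtain ⟨s, ⟨hs, hs'⟩, -⟩ := Set.mem_iUnion₂.1 hx
  obtain ⟨y, hy⟩ := nonempty_of_mem_faces hs
  have : Nonempty {y : E // y ≠ v ∧ {v, y} ∈ K.faces} := ⟨⟨y, hvert hs' hy⟩⟩
  refine ⟨fun a b => ?_⟩
  by_contra hab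
  let A : Set E := {y | ∃ c, (K.linkGraph v).Reachable a c ∧ c.1 = y}
  let P (q : Finset E → Prop) : Set E :=
    ⋃ s ∈ {s | s ∈ K.faces ∧ q s}, convexHull ℝ (s : Set E)
  have hP (q) : IsClosed (P q) := (hK.subset fun s hs => hs.1).isClosed_biUnion
    fun s _ => s.finite_toSet.isClosed_convexHull ℝ
  have hmem (c : {y : E // y ≠ v ∧ {v, y} ∈ K.faces}) :
      {c.1} ∈ K.faces ∧ c.1 ∈ ⋃ s ∈ {s | s ∈ K.faces ∧ v ∉ s ∧ insert v s ∈ K.faces},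
        convexHull ℝ (s : Set E) := by
    have hc : {c.1} ∈ K.faces :=
      K.down_closed c.2.2 (by simp) (Finset.singleton_nonempty _)
    exact ⟨hc, Set.mem_iUnion₂.2 ⟨{c.1}, ⟨hc, by simpa using c.2.1.symm, c.2.2⟩, by simp⟩⟩
  have hcover : ⋃ s ∈ {s | s ∈ K.faces ∧ v ∉ s ∧ insert v s ∈ K.faces}, convexHull ℝ (s : Set E) ⊆
      P (fun s => ∀ y ∈ s, y ∈ A) ∪ P (fun s => ∀ y ∈ s, y ∉ A) := by
    intro x hx
    obtain ⟨s, ⟨hs, hs'⟩, hxs⟩ := Set.mem_iUnion₂.1 hx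
    by_cases h : ∃ y ∈ s, y ∈ A
    · left
      obtain ⟨y, hys, c, hc, rfl⟩ := h
      refine Set.mem_iUnion₂.2 ⟨s, ⟨hs, fun z hz => ?_⟩, hxs⟩
      let d : {y : E // y ≠ v ∧ {v, y} ∈ K.faces} := ⟨z, hvert hs' hz⟩
      rcases eq_or_ne c d with hcd | hcd
      · exact ⟨c, hc, congrArg Subtype.val hcd⟩
      · have hadj : (K.linkGraph v).Adj c d :=
          ⟨hcd, K.down_closed hs'.2 (by simp [Finset.insert_subset_iff, hys, hz, d])
            (Finset.insert_nonempty _ _)⟩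
        exact ⟨d, hc.trans hadj.reachable, rfl⟩
    · right
      push Not at h
      exact Set.mem_iUnion₂.2 ⟨s, ⟨hs, h⟩, hxs⟩
  have hb : b.1 ∉ A := fun ⟨c, hc, hcb⟩ => hab (Subtype.ext hcb ▸ hc)
  obtain ⟨x, -, hx1, hx2⟩ := isPreconnected_closed_iff.1 hpre _ _ (hP _) (hP _) hcover
    ⟨a.1, (hmem a).2, Set.mem_iUnion₂.2 ⟨{a.1}, ⟨(hmem a).1, fun y hy =>
      Finset.mem_singleton.1 hy ▸ ⟨a, .refl a, rfl⟩⟩, by simp⟩⟩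
    ⟨b.1, (hmem b).2, Set.mem_iUnion₂.2 ⟨{b.1}, ⟨(hmem b).1, fun y hy =>
      Finset.mem_singleton.1 hy ▸ hb⟩, by simp⟩⟩
  obtain ⟨s, ⟨hs, hsA⟩, hxs⟩ := Set.mem_iUnion₂.1 hx1
  obtain ⟨t, ⟨ht, htA⟩, hxt⟩ := Set.mem_iUnion₂.1 hx2
  obtain ⟨y, hys, hyt⟩ := convexHull_nonempty_iff.1
    ⟨x, K.inter_subset_convexHull hs ht ⟨hxs, hxt⟩⟩
  exact htA y hyt (hsA y hys)

/-- The link of a vertex is a polygon. -/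
theorem exists_polygon_link [TopologicalSpace E] [IsTopologicalAddGroup E] [ContinuousSMul ℝ E]
    [T2Space E] (hK : K.faces.Finite)
    (hpure : ∀ s ∈ K.faces, ∃ t ∈ K.faces, s ⊆ t ∧ t.card = 3)
    (hedge : ∀ s ∈ K.faces, s.card = 2 → {t | t ∈ K.faces ∧ t.card = 3 ∧ s ⊆ t}.ncard = 2)
    (hlink : IsConnected (⋃ s ∈ {s | s ∈ K.faces ∧ v ∉ s ∧ insert v s ∈ K.faces},
      convexHull ℝ (s : Set E))) :
    ∃ n : ℕ, 3 ≤ n ∧ ∃ w : ZMod n → E, Function.Injective w ∧ (∀ k, w k ≠ v) ∧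
      (∀ k, {v, w k, w (k + 1)} ∈ K.faces) ∧
      ∀ s ∈ K.faces, v ∈ s → ∃ k, s ⊆ {v, w k, w (k + 1)} := by
  have := finite_linkGraph_vertices (v := v) hK
  obtain ⟨n, hn, w, hw, hadj, hnbr⟩ := (K.linkGraph v).exists_cyclic_labelling
    (linkGraph_connected hK hlink) (ncard_linkGraph_neighborSet hedge)
  refine ⟨n, hn, fun k => (w k).1, Subtype.val_injective.comp hw.1, fun k => (w k).2.1,
    fun k => (hadj k).2, fun s hs hvs => ?_⟩
  obtain ⟨t, ht, hst, hcard⟩ := hpure s hs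
  have hvt := hst hvs
  obtain ⟨a, b, hab, htv⟩ := Finset.card_eq_two.1 (show (t.erase v).card = 2 by
    rw [Finset.card_erase_of_mem hvt, hcard])
  have ht_eq : t = {v, a, b} := by rw [← htv, Finset.insert_erase hvt]
  have ha : a ∈ t.erase v := by rw [htv]; simp
  have hb : b ∈ t.erase v := by rw [htv]; simp
  rw [Finset.mem_erase] at ha hb
  obtain ⟨k, hk⟩ := hw.2 ⟨a, mem_linkGraph_vertices ht hvt ha.2 ha.1⟩
  have hkb : (K.linkGraph v).Adj (w k) ⟨b, mem_linkGraph_vertices ht hvt hb.2 hb.1⟩ := by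
    rw [hk]
    exact ⟨fun h => hab (congrArg Subtype.val h), ht_eq ▸ ht⟩
  have hka : (w k).1 = a := congrArg Subtype.val hk
  rcases hnbr k _ hkb with h | h
  · refine ⟨k, hst.trans ?_⟩
    change t ⊆ {v, (w k).1, (w (k + 1)).1}
    rw [← h, hka]
    exact ht_eq.subset
  · refine ⟨k - 1, hst.trans ?_⟩
    change t ⊆ {v, (w (k - 1)).1, (w (k - 1 + 1)).1}
    rw [sub_add_cancel, ← h, hka, Finset.pair_comm]
    exact ht_eq.subset

/-- Every point of a finite pure 2-dimensional complex with two triangles at every edge and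
connected links has a neighbourhood homeomorphic to an open subset of the plane. -/
theorem exists_isOpen_homeomorph_plane [TopologicalSpace E] [IsTopologicalAddGroup E]
    [ContinuousSMul ℝ E] [T2Space E] (hK : K.faces.Finite)
    (hpure : ∀ s ∈ K.faces, ∃ t ∈ K.faces, s ⊆ t ∧ t.card = 3)
    (hedge : ∀ s ∈ K.faces, s.card = 2 → {t | t ∈ K.faces ∧ t.card = 3 ∧ s ⊆ t}.ncard = 2)
    (hlink : ∀ v, {v} ∈ K.faces →
      IsConnected (⋃ s ∈ {s | s ∈ K.faces ∧ v ∉ s ∧ insert v s ∈ K.faces},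
        convexHull ℝ (s : Set E))) (x : K.space) :
    ∃ (U : Set K.space) (V : Set (Fin 2 → ℝ)),
      IsOpen U ∧ IsOpen V ∧ x ∈ U ∧ Nonempty (U ≃ₜ V) := by
  obtain ⟨v, hv, hx⟩ := exists_forall_mem_of_mem_space x.2
  obtain ⟨n, hn, w, hw, hwv, hface, hstar⟩ := exists_polygon_link hK hpure hedge (hlink v hv)
  have : NeZero n := ⟨by omega⟩
  exact exists_homeomorph_of_mem_star hK hn hw hwv hface hstar x hx

end LinkGraph

end Geometry.SimplicialComplex

/-- A finite pure 2-dimensional simplicial complex in `ℝ³` in which every edge has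
exactly two triangle cofaces and the link of every vertex has connected nonempty
realization is a topological 2-manifold. -/
theorem pure2_complex_is_2manifold (K : Set (Finset (Fin 3 → ℝ)))
    (hfin : K.Finite)
    (hne : ∀ s ∈ K, s.Nonempty)
    (hindep : ∀ s ∈ K, AffineIndependent ℝ (fun x : s => (x : Fin 3 → ℝ)))
    (hdown : ∀ s ∈ K, ∀ t : Finset (Fin 3 → ℝ), t ⊆ s → t.Nonempty → t ∈ K)
    (hglue : ∀ s ∈ K, ∀ t ∈ K,
      convexHull ℝ (s : Set (Fin 3 → ℝ)) ∩ convexHull ℝ (t : Set (Fin 3 → ℝ))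
        = convexHull ℝ ((s ∩ t : Finset (Fin 3 → ℝ)) : Set (Fin 3 → ℝ)))
    (hpure : ∀ s ∈ K, ∃ t ∈ K, s ⊆ t ∧ t.card = 3)
    (hedge : ∀ s ∈ K, s.card = 2 →
      {t | t ∈ K ∧ t.card = 3 ∧ s ⊆ t}.ncard = 2)
    (hlink : ∀ v : Fin 3 → ℝ, {v} ∈ K →
      IsConnected (⋃ s ∈ {s | s ∈ K ∧ v ∉ s ∧ insert v s ∈ K},
        convexHull ℝ (s : Set (Fin 3 → ℝ)))) :
    Is2Manifold (⋃ s ∈ K, convexHull ℝ (s : Set (Fin 3 → ℝ))) := by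
  let L : Geometry.SimplicialComplex ℝ (Fin 3 → ℝ) :=
    { faces := K
      isRelLowerSet_faces := fun s hs => ⟨hne s hs, fun t hts ht => hdown s hs t hts ht⟩
      indep := fun {s} hs => hindep s hs
      inter_subset_convexHull := fun {s t} hs ht => by
        rw [hglue s hs t ht, Finset.coe_inter] }
  exact L.exists_isOpen_homeomorph_plane hfin hpure hedge fun v hv => by convert hlink v hv
end

section
/- Let G = { q ∈ ℤ³ : for every j, q_j ≡ 0 or 2 (mod 4) }, for q ∈ G let d(q) = #{ j : q_j ≡ 0 (mod 4) }, for ℓ ∈ {0,1,2,3} let S_ℓ = { p ∈ ℤ³ : exactly ℓ coordinates of p are divisible by 4 }, and for q ∈ ℤ³ let N^{≤1}(q) = { p ∈ ℤ³ : |p_j − q_j| ≤ 1 for all j }. Then for any two distinct points q₁, q₂ ∈ G, the sets S_{d(q₁)} ∩ N^{≤1}(q₁) and S_{d(q₂)} ∩ N^{≤1}(q₂) are disjoint. (This is the key claim in the proof that the repaired grayscale image g_P is well-defined: the color-changing operations performed around distinct cells of the cubical complex never conflict.) -/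
/-- Points of `ℤ³` all of whose coordinates are `≡ 0` or `2 (mod 4)`
(the points representing cells in the ECM representation). -/
def ECMGrid : Set (Fin 3 → ℤ) :=
  {q | ∀ j, q j % 4 = 0 ∨ q j % 4 = 2}

/-- The dimension of the cell represented by `q`: the number of coordinates of `q`
divisible by 4. -/
def ecmDim (q : Fin 3 → ℤ) : ℕ :=
  (Finset.univ.filter fun j => q j % 4 = 0).card

/-- `S_ℓ`: points of `ℤ³` with exactly `ℓ` coordinates divisible by 4. -/
def ecmStratum (ℓ : ℕ) : Set (Fin 3 → ℤ) :=
  {p | (Finset.univ.filter fun j => (4 : ℤ) ∣ p j).card = ℓ}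

/-- The `3×3×3` block `N^{≤1}(q)` centered at `q`. -/
def block1 (q : Fin 3 → ℤ) : Set (Fin 3 → ℤ) :=
  {p | ∀ j, |p j - q j| ≤ 1}

/-- A point of the block around a grid point `q` lying in the stratum of dimension `ecmDim q`
has the same coordinates divisible by 4 as `q`. -/
theorem four_dvd_iff_of_mem_stratum_inter_block {q p : Fin 3 → ℤ} (hq : q ∈ ECMGrid)
    (hp : p ∈ ecmStratum (ecmDim q) ∩ block1 q) (j : Fin 3) :
    (4 : ℤ) ∣ p j ↔ q j % 4 = 0 := by
  obtain ⟨hcard, hblock⟩ := hp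
  have hsub : (Finset.univ.filter fun j => (4 : ℤ) ∣ p j) ⊆
      Finset.univ.filter fun j => q j % 4 = 0 := by
    intro i hi
    simp only [Finset.mem_filter, Finset.mem_univ, true_and] at hi ⊢
    have hd := abs_le.mp (hblock i)
    have hr := hq i
    omega
  have heq := Finset.eq_of_subset_of_card_le hsub (le_of_eq (Eq.symm hcard))
  simpa using Finset.ext_iff.mp heq j

/-- The recoloring regions associated to distinct cell-representing points never overlap:
for distinct `q₁, q₂ ∈ G`, the sets `S_{d(q₁)} ∩ N^{≤1}(q₁)` and `S_{d(q₂)} ∩ N^{≤1}(q₂)`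
are disjoint. -/
theorem recoloring_regions_disjoint (q₁ q₂ : Fin 3 → ℤ)
    (h₁ : q₁ ∈ ECMGrid) (h₂ : q₂ ∈ ECMGrid) (hne : q₁ ≠ q₂) :
    Disjoint (ecmStratum (ecmDim q₁) ∩ block1 q₁)
      (ecmStratum (ecmDim q₂) ∩ block1 q₂) := by
  rw [Set.disjoint_left]
  intro p hp₁ hp₂
  refine hne (funext fun j => ?_)
  have e₁ := four_dvd_iff_of_mem_stratum_inter_block h₁ hp₁ j
  have e₂ := four_dvd_iff_of_mem_stratum_inter_block h₂ hp₂ j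
  have b₁ := abs_le.mp (hp₁.2 j)
  have b₂ := abs_le.mp (hp₂.2 j)
  have r₁ := h₁ j
  have r₂ := h₂ j
  omega
end

section
/- Let B = {(0,0,0), (1,1,0)} ⊆ ℤ³, so that C(B) is the union of two closed unit cubes sharing exactly one edge. Then every point x of the common edge { (1/2, 1/2, t) : −1/2 ≤ t ≤ 1/2 } lies in the frontier of C(B), and no open neighborhood of x in the frontier of C(B) (with the subspace topology) is homeomorphic to an open subset of ℝ². In particular the frontier of C(B) is not a topological 2-manifold, i.e. the image with foreground B is not well-composed. (The edge-adjacency critical configuration.) -/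
/-- The edge-adjacency configuration: two unit cubes sharing exactly one edge. -/
def edgeConfig : Set (Fin 3 → ℤ) := {![0, 0, 0], ![1, 1, 0]}

open Complex in
/-- Two continuous logarithms of one function on a preconnected set differ by a constant
multiple of `2πi`. -/
theorem exists_int_sub_eq_of_exp_eq {X : Type*} [TopologicalSpace X] {s : Set X}
    (hs : IsPreconnected s) {F G : X → ℂ} (hF : ContinuousOn F s) (hG : ContinuousOn G s)
    (h : ∀ x ∈ s, exp (F x) = exp (G x)) :
    ∃ n : ℤ, ∀ x ∈ s, F x - G x = n * (2 * Real.pi * I) := by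
  have key : ∀ x ∈ s, ∃ n : ℤ, F x = G x + n * (2 * Real.pi * I) :=
    fun x hx ↦ exp_eq_exp_iff_exists_int.1 (h x hx)
  have hpi : (2 * Real.pi * I : ℂ) ≠ 0 := two_pi_I_ne_zero
  have hdisc : IsDiscrete (Set.range ((↑) : ℤ → ℝ)) :=
    Int.isClosedEmbedding_coe_real.isEmbedding.isInducing.isDiscrete_range
  obtain ⟨-, ⟨n, rfl⟩, hn⟩ := hs.eqOn_const_of_mapsTo (T := Set.range ((↑) : ℤ → ℝ))
    hdisc
    (f := fun x ↦ ((F x - G x) / (2 * Real.pi * I)).re)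
    (continuous_re.comp_continuousOn ((hF.sub hG).div_const _))
    (fun x hx ↦ by
      obtain ⟨n, hn⟩ := key x hx
      exact ⟨n, by simp [hn, hpi]⟩) (Set.range_nonempty _)
  refine ⟨n, fun x hx ↦ ?_⟩
  obtain ⟨m, hm⟩ := key x hx
  have := hn hx
  simp only [hm, add_sub_cancel_left, mul_div_cancel_right₀ _ hpi, intCast_re,
    Function.const_apply, Int.cast_inj] at this
  rw [hm, this, add_sub_cancel_left]

open Complex Metric in
/-- A nonvanishing continuous function on a punctured disc has a degree `n`: a loop winding `m`
times around the puncture is sent to a loop winding `n * m` times around the origin. -/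
theorem exists_degree_of_continuousOn_punctured_ball {R : ℝ} (hR : 0 < R) (p : ℂ) {f : ℂ → ℂ}
    (hf : ContinuousOn f (ball p R \ {p})) (hf0 : ∀ z ∈ ball p R \ {p}, f z ≠ 0) :
    ∃ n : ℤ, ∀ Γ F : ℝ → ℂ, Continuous Γ → Continuous F → (∀ s, ‖exp (Γ s)‖ < R) →
      (∀ s, exp (F s) = f (p + exp (Γ s))) → ∀ (a b : ℝ) (m : ℤ),
      Γ b - Γ a = m * (2 * Real.pi * I) → F b - F a = n * (m * (2 * Real.pi * I)) := by
  set H : Set ℂ := {z | z.re < Real.log R} with hH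
  have hmem : ∀ z, z ∈ H ↔ ‖exp z‖ < R := fun z ↦ by
    rw [norm_exp, hH, Set.mem_ofPred_eq, Real.lt_log_iff_exp_lt hR]
  have hHc : Convex ℝ H := convex_halfSpace_re_lt _
  have hHo : IsOpen H := isOpen_lt continuous_re continuous_const
  have hHne : H.Nonempty := ⟨((Real.log R - 1 : ℝ) : ℂ), by simp [hH, -ofReal_sub]⟩
  have hmaps : ∀ z ∈ H, p + exp z ∈ ball p R \ {p} := fun z hz ↦ by
    simpa [mem_ball_iff_norm, exp_ne_zero] using (hmem z).1 hz
  have := hHc.contractibleSpace hHne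
  obtain ⟨h, hc, he⟩ := exists_continuousOn_eqOn_exp_comp (U := H)
    (SimplyConnectedSpace.ofContractible H) hHo
    (g := fun z ↦ f (p + exp z)) (hf.comp (by fun_prop) hmaps) (by
      rintro ⟨z, hz, h0⟩
      exact hf0 _ (hmaps z hz) h0)
  have hshift : ∀ z ∈ H, ∀ m : ℤ, z + m * (2 * Real.pi * I) ∈ H := fun z hz m ↦ by
    simpa [hH] using hz
  have hshift1 : ∀ z ∈ H, z + 2 * Real.pi * I ∈ H := fun z hz ↦ by
    simpa using hshift z hz 1
  obtain ⟨n, hn⟩ := exists_int_sub_eq_of_exp_eq hHc.isPreconnected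
    (F := fun z ↦ h (z + 2 * Real.pi * I)) (G := h) (hc.comp (by fun_prop) hshift1) hc
    (fun z hz ↦ by
      have h1 := he (hshift1 z hz)
      have h2 := he hz
      simp only [Function.comp_apply, exp_periodic z] at h1 h2
      rw [h1, h2])
  have hnm : ∀ z ∈ H, ∀ m : ℤ,
      h (z + m * (2 * Real.pi * I)) - h z = n * (m * (2 * Real.pi * I)) := fun z hz m ↦ by
    induction m using Int.induction_on with
    | zero => simp
    | succ k ih =>
      have := hn _ (hshift z hz k)
      push_cast at this ih ⊢
      rw [show z + (k + 1 : ℂ) * (2 * Real.pi * I)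
        = z + k * (2 * Real.pi * I) + 2 * Real.pi * I by ring]
      linear_combination this + ih
    | pred k ih =>
      have := hn _ (hshift z hz (-k - 1))
      push_cast at this ih ⊢
      rw [show z + (-k - 1 : ℂ) * (2 * Real.pi * I) + 2 * Real.pi * I
        = z + -k * (2 * Real.pi * I) by ring] at this
      linear_combination ih - this
  refine ⟨n, fun Γ F hΓ hF hΓR hFf a b m hab ↦ ?_⟩
  have hΓH : ∀ s, Γ s ∈ H := fun s ↦ (hmem _).2 (hΓR s)
  obtain ⟨k, hk⟩ := exists_int_sub_eq_of_exp_eq isPreconnected_univ (F := F)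
    (G := fun s ↦ h (Γ s)) hF.continuousOn
    (hc.comp_continuous hΓ hΓH).continuousOn (fun s _ ↦ by
      rw [hFf]; exact (he (hΓH s)).symm)
  have h1 := hk a trivial
  have h2 := hk b trivial
  have h3 := hnm _ (hΓH a) m
  rw [← hab, add_sub_cancel] at h3
  rw [hab] at h3
  linear_combination h2 - h1 + h3

open Complex in
/-- A path avoiding `p` has a continuous logarithm relative to `p`. -/
theorem exists_continuous_log_sub {p : ℂ} {γ : ℝ → ℂ} (hγ : Continuous γ) (hp : ∀ s, γ s ≠ p) :
    ∃ Γ : ℝ → ℂ, Continuous Γ ∧ ∀ s, p + exp (Γ s) = γ s := by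
  have := (convex_univ (𝕜 := ℝ) (E := ℝ)).contractibleSpace Set.univ_nonempty
  obtain ⟨Γ, hc, he⟩ := exists_continuousOn_eqOn_exp_comp (U := (Set.univ : Set ℝ))
    (SimplyConnectedSpace.ofContractible (Set.univ : Set ℝ))
    isOpen_univ (g := fun s ↦ γ s - p) (by fun_prop) (by
      rintro ⟨s, -, h0⟩
      exact hp s (sub_eq_zero.1 h0))
  refine ⟨Γ, continuousOn_univ.1 hc, fun s ↦ ?_⟩
  have := he (Set.mem_univ s)
  simp only [Function.comp_apply] at this
  rw [this, add_sub_cancel]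

open Complex in
theorem exp_log_add_mul_I {r : ℝ} (hr : 0 < r) (θ : ℝ) :
    exp (Real.log r + θ * I) = ⟨r * Real.cos θ, r * Real.sin θ⟩ := by
  rw [Complex.exp_add, ← ofReal_exp, Real.exp_log hr, exp_mul_I, ← ofReal_cos, ← ofReal_sin]
  apply Complex.ext <;> simp [-ofReal_cos, -ofReal_sin]

theorem Real.sin_arccos_cos (s : ℝ) : Real.sin (Real.arccos (Real.cos s)) = |Real.sin s| := by
  rw [Real.sin_arccos, Real.abs_sin_eq_sqrt_one_sub_cos_sq]

open Complex Metric in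
/-- The two crossing planes `y 0 * y 1 = 0` of `ℝ³`, punctured at the origin, are not parametrized
by a punctured disc in such a way that circles in both planes lift to loops in the disc. Each plane
gives a folding map to the plane with degree one on its own circle; the one folding along the
second plane has degree zero on the circle in the first, so the degrees are incompatible. -/
theorem no_punctured_disc_chart_of_crossing_planes {R : ℝ} (hR : 0 < R) {p : ℂ}
    {ψ : ℂ → Fin 3 → ℝ} (hψ : ContinuousOn ψ (ball p R \ {p}))
    (h0 : ∀ z ∈ ball p R \ {p}, ψ z 0 * ψ z 1 = 0 ∧ ψ z ≠ 0) {r : ℝ} (hr : 0 < r)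
    {α β : ℝ → ℂ} (hα : Continuous α) (hβ : Continuous β)
    (hαR : ∀ s, α s ∈ ball p R \ {p}) (hβR : ∀ s, β s ∈ ball p R \ {p})
    (hα_loop : α (2 * Real.pi) = α 0) (hβ_loop : β (2 * Real.pi) = β 0)
    (hψα : ∀ s, ψ (α s) = ![r * Real.sin s, 0, r * Real.cos s])
    (hψβ : ∀ s, ψ (β s) = ![0, r * Real.sin s, r * Real.cos s]) : False := by
  have hpi : (2 * Real.pi * I : ℂ) ≠ 0 := two_pi_I_ne_zero
  have hcoord : ∀ i, ContinuousOn (fun z ↦ ψ z i) (ball p R \ {p}) :=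
    fun i ↦ (continuous_apply i).comp_continuousOn hψ
  have hfold : ∀ i j : Fin 3, (∀ y : Fin 3 → ℝ, y 0 * y 1 = 0 → y i = |y j| → y 2 = 0 → y = 0) →
      ∃ n : ℤ, ∀ Γ F : ℝ → ℂ, Continuous Γ → Continuous F → (∀ s, ‖exp (Γ s)‖ < R) →
      (∀ s, exp (F s) = ⟨ψ (p + exp (Γ s)) 2, ψ (p + exp (Γ s)) i - |ψ (p + exp (Γ s)) j|⟩) →
      ∀ (a b : ℝ) (m : ℤ),
      Γ b - Γ a = m * (2 * Real.pi * I) → F b - F a = n * (m * (2 * Real.pi * I)) := by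
    intro i j hij
    refine exists_degree_of_continuousOn_punctured_ball hR p
      (f := fun z ↦ ⟨ψ z 2, ψ z i - |ψ z j|⟩) ?_ fun z hz hfz ↦ (h0 z hz).2 ?_
    · exact equivRealProdCLM.symm.continuous.comp_continuousOn
        ((hcoord 2).prodMk ((hcoord i).sub (hcoord j).abs))
    · rw [Complex.ext_iff] at hfz
      exact hij _ (h0 z hz).1 (sub_eq_zero.1 hfz.2) hfz.1
  obtain ⟨n₁, hn₁⟩ := hfold 0 1 (fun y h1 h2 h3 ↦ by
    have h : y 0 = 0 ∧ y 1 = 0 := by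
      rcases mul_eq_zero.1 h1 with h | h <;> simp_all
    ext k; fin_cases k <;> simp [h, h3])
  obtain ⟨n₂, hn₂⟩ := hfold 1 0 (fun y h1 h2 h3 ↦ by
    have h : y 0 = 0 ∧ y 1 = 0 := by
      rcases mul_eq_zero.1 h1 with h | h <;> simp_all
    ext k; fin_cases k <;> simp [h, h3])
  have hlog : ∀ γ : ℝ → ℂ, Continuous γ → (∀ s, γ s ∈ ball p R \ {p}) →
      γ (2 * Real.pi) = γ 0 → ∃ (Γ : ℝ → ℂ) (m : ℤ), Continuous Γ ∧ (∀ s, p + exp (Γ s) = γ s) ∧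
        (∀ s, ‖exp (Γ s)‖ < R) ∧ Γ (2 * Real.pi) - Γ 0 = m * (2 * Real.pi * I) := by
    intro γ hγ hγR hloop
    obtain ⟨Γ, hΓ, he⟩ := exists_continuous_log_sub hγ fun s ↦ (hγR s).2
    have h1 : exp (Γ (2 * Real.pi)) = exp (Γ 0) := by
      rw [← add_right_inj p, he, he, hloop]
    obtain ⟨m, hm⟩ := exp_eq_exp_iff_exists_int.1 h1
    refine ⟨Γ, m, hΓ, he, fun s ↦ ?_, by rw [hm, add_sub_cancel_left]⟩
    have := (hγR s).1
    rwa [← he s, mem_ball_iff_norm, add_sub_cancel_left] at this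
  obtain ⟨A, a, hA, hAα, hAR, ha⟩ := hlog α hα hαR hα_loop
  obtain ⟨B, b, hB, hBβ, hBR, hb⟩ := hlog β hβ hβR hβ_loop
  have e₁ := hn₁ A (fun s ↦ Real.log r + s * I) hA (by fun_prop) hAR (fun s ↦ by
    rw [hAα, hψα, exp_log_add_mul_I hr]; simp) _ _ a ha
  have e₂ := hn₂ A (fun s ↦ Real.log r + (-Real.arccos (Real.cos s) : ℝ) * I) hA
    (by fun_prop) hAR (fun s ↦ by
      rw [hAα, hψα, exp_log_add_mul_I hr, Real.cos_neg, Real.sin_neg, Real.sin_arccos_cos,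
        Real.cos_arccos (Real.neg_one_le_cos s) (Real.cos_le_one s)]
      simp [abs_mul, abs_of_pos hr]) _ _ a ha
  have e₃ := hn₂ B (fun s ↦ Real.log r + s * I) hB (by fun_prop) hBR (fun s ↦ by
    rw [hBβ, hψβ, exp_log_add_mul_I hr]; simp) _ _ b hb
  have key₁ : (n₁ * a : ℂ) = 1 := mul_right_cancel₀ hpi (by
    push_cast at e₁; linear_combination -e₁)
  have key₂ : (n₂ * a : ℂ) = 0 := mul_right_cancel₀ hpi (by
    simp only [Real.cos_two_pi, Real.cos_zero, sub_self] at e₂; linear_combination -e₂)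
  have key₃ : (n₂ * b : ℂ) = 1 := mul_right_cancel₀ hpi (by
    push_cast at e₃; linear_combination -e₃)
  have : (1 : ℂ) = 0 := by linear_combination n₁ * b * key₂ - n₂ * b * key₁ - key₃
  exact one_ne_zero this

theorem mem_contAnalog_edgeConfig {x : Fin 3 → ℝ} :
    x ∈ contAnalog edgeConfig ↔
      (|x 0| ≤ 1 / 2 ∧ |x 1| ≤ 1 / 2 ∧ |x 2| ≤ 1 / 2) ∨
        (|x 0 - 1| ≤ 1 / 2 ∧ |x 1 - 1| ≤ 1 / 2 ∧ |x 2| ≤ 1 / 2) := by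
  simp [contAnalog, edgeConfig, Fin.forall_fin_succ]

theorem isClosed_contAnalog_edgeConfig : IsClosed (contAnalog edgeConfig) := by
  rw [show contAnalog edgeConfig = {x | _} from Set.ext fun _ ↦ mem_contAnalog_edgeConfig]
  refine IsClosed.union ?_ ?_ <;>
    exact .and (isClosed_le (by fun_prop) continuous_const)
      (.and (isClosed_le (by fun_prop) continuous_const)
        (isClosed_le (by fun_prop) continuous_const))

theorem mem_frontier_of_mul_eq_zero {x : Fin 3 → ℝ} (h : (x 0 - 1 / 2) * (x 1 - 1 / 2) = 0)
    (h0 : |x 0 - 1 / 2| ≤ 1) (h1 : |x 1 - 1 / 2| ≤ 1) (h2 : |x 2| ≤ 1 / 2) :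
    x ∈ frontier (contAnalog edgeConfig) := by
  rw [isClosed_contAnalog_edgeConfig.frontier_eq]
  refine ⟨?_, fun hint ↦ ?_⟩
  · rw [mem_contAnalog_edgeConfig]
    simp only [abs_le] at *
    rcases mul_eq_zero.1 h with h | h <;> grind
  · obtain ⟨ε, hε, hball⟩ := Metric.mem_nhds_iff.1 (mem_interior_iff_mem_nhds.1 hint)
    have hnot : ∀ d : ℝ, |d| = ε / 2 →
        ¬ ((x 0 - 1 / 2 + d) * (x 1 - 1 / 2 - d) < 0) := fun d hd hlt ↦ by
      have hmem : ![x 0 + d, x 1 - d, x 2] ∈ Metric.ball x ε := by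
        rw [Metric.mem_ball, dist_pi_lt_iff hε]
        intro k
        fin_cases k <;> simp [hd, hε]
      have := mem_contAnalog_edgeConfig.1 (hball hmem)
      simp only [Matrix.cons_val, abs_le] at this
      rcases this with ⟨⟨-, ha⟩, ⟨-, hb⟩, -⟩ | ⟨⟨ha, -⟩, ⟨hb, -⟩, -⟩ <;> nlinarith
    have hd1 := hnot (ε / 2) (abs_of_pos (by positivity))
    have hd2 := hnot (-(ε / 2)) (by rw [abs_neg, abs_of_pos (by positivity)])
    rcases mul_eq_zero.1 h with h | h <;> rw [h] at hd1 hd2 <;> nlinarith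

theorem mul_eq_zero_of_mem_frontier {x : Fin 3 → ℝ} (hx : x ∈ frontier (contAnalog edgeConfig))
    (h0 : |x 0 - 1 / 2| < 1) (h1 : |x 1 - 1 / 2| < 1) (h2 : |x 2| < 1 / 2) :
    (x 0 - 1 / 2) * (x 1 - 1 / 2) = 0 := by
  rw [isClosed_contAnalog_edgeConfig.frontier_eq] at hx
  obtain ⟨hmem, hint⟩ := hx
  by_contra hne
  refine hint (mem_interior_iff_mem_nhds.2 ?_)
  have hpos : 0 < (x 0 - 1 / 2) * (x 1 - 1 / 2) := by
    refine lt_of_le_of_ne ?_ (Ne.symm hne)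
    rw [mem_contAnalog_edgeConfig] at hmem
    simp only [abs_le] at hmem
    rcases hmem with ⟨⟨-, ha⟩, ⟨-, hb⟩, -⟩ | ⟨⟨ha, -⟩, ⟨hb, -⟩, -⟩ <;> nlinarith
  have hopen : IsOpen {y : Fin 3 → ℝ | 0 < (y 0 - 1 / 2) * (y 1 - 1 / 2) ∧ |y 0 - 1 / 2| < 1 ∧
      |y 1 - 1 / 2| < 1 ∧ |y 2| < 1 / 2} :=
    .and (isOpen_lt continuous_const (by fun_prop))
      (.and (isOpen_lt (by fun_prop) continuous_const)
        (.and (isOpen_lt (by fun_prop) continuous_const)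
          (isOpen_lt (by fun_prop) continuous_const)))
  filter_upwards [hopen.mem_nhds ⟨hpos, h0, h1, h2⟩] with y ⟨hy, hy0, hy1, hy2⟩
  rw [mem_contAnalog_edgeConfig]
  simp only [abs_lt, abs_le] at *
  rcases mul_pos_iff.1 hy with ⟨ha, hb⟩ | ⟨ha, hb⟩
  · right; refine ⟨⟨?_, ?_⟩, ⟨?_, ?_⟩, ?_, ?_⟩ <;> linarith
  · left; refine ⟨⟨?_, ?_⟩, ⟨?_, ?_⟩, ?_, ?_⟩ <;> linarith

open Metric in
/-- No open neighborhood in the frontier of a relative interior point of the common edge embeds as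
an open subset of the plane. -/
theorem not_isOpenEmbedding_of_mem_open_edge {t : ℝ} (ht : |t| < 1 / 2)
    (hx : (![1 / 2, 1 / 2, t] : Fin 3 → ℝ) ∈ frontier (contAnalog edgeConfig))
    {U : Set (frontier (contAnalog edgeConfig))} (hU : IsOpen U)
    (hxU : (⟨![1 / 2, 1 / 2, t], hx⟩ : frontier (contAnalog edgeConfig)) ∈ U)
    {χ : U → ℂ} : ¬ Topology.IsOpenEmbedding χ := by
  intro hχ
  set x : Fin 3 → ℝ := ![1 / 2, 1 / 2, t] with hxdef
  set x₀ : U := ⟨⟨x, hx⟩, hxU⟩ with hx₀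
  have : Nonempty U := ⟨x₀⟩
  have hval : ∀ i, Continuous fun y : U ↦ y.1.1 i := fun i ↦
    (continuous_apply i).comp (continuous_subtype_val.comp continuous_subtype_val)
  set N : Set U := {y | |y.1.1 0 - 1 / 2| < 1 ∧ |y.1.1 1 - 1 / 2| < 1 ∧ |y.1.1 2| < 1 / 2} with hN
  have hNo : IsOpen N :=
    .and (isOpen_lt ((hval 0).sub continuous_const).abs continuous_const)
      (.and (isOpen_lt ((hval 1).sub continuous_const).abs continuous_const)
        (isOpen_lt (hval 2).abs continuous_const))
  have hxN : x₀ ∈ N := by simpa [hN, hx₀, hxdef] using ht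
  obtain ⟨R, hR, hRN⟩ := Metric.isOpen_iff.1 (hχ.isOpenMap N hNo) (χ x₀) ⟨x₀, hxN, rfl⟩
  set e := hχ.toOpenPartialHomeomorph χ with he
  have hleft : ∀ y, e.symm (χ y) = y := fun y ↦ hχ.toOpenPartialHomeomorph_left_inv
  have hballt : ball (χ x₀) R ⊆ e.target := fun z hz ↦ by
    obtain ⟨y, -, rfl⟩ := hRN hz
    simp [he]
  set ψ : ℂ → Fin 3 → ℝ := fun z ↦ (e.symm z).1.1 - x with hψ
  obtain ⟨ρ, hρ, hρO⟩ : ∃ ρ > 0, ∀ y (hy : y ∈ frontier (contAnalog edgeConfig)),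
      dist y x < ρ → ∃ h : (⟨y, hy⟩ : frontier (contAnalog edgeConfig)) ∈ U, χ ⟨⟨y, hy⟩, h⟩ ∈ ball (χ x₀) R := by
    obtain ⟨ρ, hρ, h⟩ := Metric.isOpen_iff.1
      (hU.isOpenMap_subtype_val _ ((isOpen_ball (x := χ x₀) (ε := R)).preimage hχ.continuous))
      x₀.1 ⟨x₀, mem_ball_self hR, rfl⟩
    refine ⟨ρ, hρ, fun y hy hd ↦ ?_⟩
    obtain ⟨w, hw, hwy⟩ := h
      (show (⟨y, hy⟩ : frontier (contAnalog edgeConfig)) ∈ ball x₀.1 ρ from hd)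
    have hmem : (⟨y, hy⟩ : frontier (contAnalog edgeConfig)) ∈ U := hwy ▸ w.2
    have : w = ⟨⟨y, hy⟩, hmem⟩ := Subtype.ext hwy
    exact ⟨hmem, this ▸ hw⟩
  obtain ⟨r, hr, hrρ, hr1, hrt⟩ : ∃ r : ℝ, 0 < r ∧ r < ρ ∧ r < 1 ∧ r < 1 / 2 - |t| := by
    obtain ⟨r, hr0, hr⟩ := exists_between (lt_min hρ (lt_min one_pos (sub_pos.2 ht)))
    simp only [lt_min_iff] at hr
    exact ⟨r, hr0, hr⟩
  have hloop : ∀ c : ℝ → Fin 3 → ℝ, Continuous c → c (2 * Real.pi) = c 0 →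
      (∀ s, c s 0 * c s 1 = 0 ∧ ‖c s‖ ≤ r ∧ c s ≠ 0) → ∃ γ : ℝ → ℂ, Continuous γ ∧
        (∀ s, γ s ∈ ball (χ x₀) R \ {χ x₀}) ∧ γ (2 * Real.pi) = γ 0 ∧ ∀ s, ψ (γ s) = c s := by
    intro c hc hper hcs
    have hcr : ∀ s i, |c s i| ≤ r := fun s i ↦ (norm_le_pi_norm (c s) i).trans (hcs s).2.1
    have hfr : ∀ s, x + c s ∈ frontier (contAnalog edgeConfig) := fun s ↦ by
      refine mem_frontier_of_mul_eq_zero ?_ ?_ ?_ ?_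
      · simpa [hxdef] using (hcs s).1
      · simpa [hxdef] using (hcr s 0).trans hr1.le
      · simpa [hxdef] using (hcr s 1).trans hr1.le
      · have := abs_add_le t (c s 2)
        have := hcr s 2
        simp only [hxdef, Pi.add_apply, Matrix.cons_val]
        linarith
    have hd : ∀ s, dist (x + c s) x < ρ := fun s ↦ by
      rw [dist_self_add_left]; exact (hcs s).2.1.trans_lt hrρ
    choose hcU hcR using fun s ↦ hρO _ (hfr s) (hd s)
    refine ⟨fun s ↦ χ ⟨⟨x + c s, hfr s⟩, hcU s⟩, hχ.continuous.comp (by fun_prop),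
      fun s ↦ ⟨hcR s, fun h ↦ (hcs s).2.2 ?_⟩, by simp only [hper], fun s ↦ ?_⟩
    · have := congrArg (fun y : U ↦ y.1.1) (hχ.injective h)
      simpa [hx₀] using this
    · simp [hψ, hleft]
  have hcirc : ∀ s : ℝ, |r| * |Real.sin s| ≤ r ∧ |r| * |Real.cos s| ≤ r := fun s ↦ by
    rw [abs_of_pos hr]
    exact ⟨mul_le_of_le_one_right hr.le (Real.abs_sin_le_one s),
      mul_le_of_le_one_right hr.le (Real.abs_cos_le_one s)⟩
  have hne : ∀ s : ℝ, r * Real.sin s = 0 → r * Real.cos s = 0 → False := fun s h1 h2 ↦ by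
    have := Real.sin_sq_add_cos_sq s
    simp_all [hr.ne']
  obtain ⟨α, hα, hαR, hαl, hαψ⟩ := hloop (fun s ↦ ![r * Real.sin s, 0, r * Real.cos s])
    (by fun_prop) (by simp) fun s ↦ ⟨by simp, by
      rw [pi_norm_le_iff_of_nonneg hr.le]
      intro i; fin_cases i <;> simp [hcirc s, hr.le], fun h ↦
      hne s (by simpa using congrFun h 0) (by simpa using congrFun h 2)⟩
  obtain ⟨β, hβ, hβR, hβl, hβψ⟩ := hloop (fun s ↦ ![0, r * Real.sin s, r * Real.cos s])
    (by fun_prop) (by simp) fun s ↦ ⟨by simp, by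
      rw [pi_norm_le_iff_of_nonneg hr.le]
      intro i; fin_cases i <;> simp [hcirc s, hr.le], fun h ↦
      hne s (by simpa using congrFun h 1) (by simpa using congrFun h 2)⟩
  refine no_punctured_disc_chart_of_crossing_planes hR (ψ := ψ) ?_ ?_ hr hα hβ hαR hβR hαl hβl
    hαψ hβψ
  · exact ((continuous_subtype_val.comp continuous_subtype_val).comp_continuousOn
      (e.continuousOn_symm.mono (Set.sdiff_subset.trans hballt))).sub continuousOn_const
  · rintro z ⟨hz, hzp⟩
    obtain ⟨y, hy, rfl⟩ := hRN hz
    refine ⟨?_, fun h ↦ hzp ?_⟩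
    · simp only [hψ, hleft, hxdef, Pi.sub_apply, Matrix.cons_val]
      exact mul_eq_zero_of_mem_frontier y.1.2 hy.1 hy.2.1 hy.2.2
    · simp only [hψ, hleft, sub_eq_zero] at h
      exact congrArg χ (Subtype.ext (Subtype.ext h))

/-- Every point of the common edge of the two cubes lies in the frontier of `C(B)` and
has no open neighborhood in the frontier homeomorphic to an open subset of `ℝ²`;
in particular the frontier of `C(B)` is not a 2-manifold: the image is not
well-composed. -/
theorem edge_adjacency_not_wellComposed :
    (∀ t : ℝ, -(1 / 2) ≤ t → t ≤ 1 / 2 →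
      ∃ hx : (![1 / 2, 1 / 2, t] : Fin 3 → ℝ) ∈ frontier (contAnalog edgeConfig),
        ∀ (U : Set (frontier (contAnalog edgeConfig))) (V : Set (Fin 2 → ℝ)),
          IsOpen U → (⟨![1 / 2, 1 / 2, t], hx⟩ : frontier (contAnalog edgeConfig)) ∈ U →
          IsOpen V → ¬ Nonempty (U ≃ₜ V)) ∧
    ¬ Is2Manifold (frontier (contAnalog edgeConfig)) := by
  have hedge : ∀ t ∈ Set.Icc (-(1 / 2) : ℝ) (1 / 2),
      (![1 / 2, 1 / 2, t] : Fin 3 → ℝ) ∈ frontier (contAnalog edgeConfig) := fun t ht ↦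
    mem_frontier_of_mul_eq_zero (by simp) (by simp) (by simp) (by simpa using abs_le.2 ht)
  have main : ∀ (t : ℝ) (ht : t ∈ Set.Icc (-(1 / 2) : ℝ) (1 / 2))
      (U : Set (frontier (contAnalog edgeConfig))) (V : Set (Fin 2 → ℝ)), IsOpen U →
      (⟨![1 / 2, 1 / 2, t], hedge t ht⟩ : frontier (contAnalog edgeConfig)) ∈ U →
      IsOpen V → ¬ Nonempty (U ≃ₜ V) := by
    rintro t ht U V hU hxU hV ⟨φ⟩
    obtain ⟨O, hO, rfl⟩ := isOpen_induced_iff.1 hU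
    have hcl : t ∈ closure (Set.Ioo (-(1 / 2) : ℝ) (1 / 2)) := by
      rwa [closure_Ioo (by norm_num)]
    obtain ⟨s, hsO, hs⟩ := mem_closure_iff.1 hcl
      ((fun s : ℝ ↦ (![1 / 2, 1 / 2, s] : Fin 3 → ℝ)) ⁻¹' O) (hO.preimage (by fun_prop)) hxU
    have hplane : Topology.IsOpenEmbedding
        (Complex.equivRealProdCLM.symm.toHomeomorph ∘ Homeomorph.finTwoArrow (X := ℝ)) :=
      (Homeomorph.isOpenEmbedding _).comp (Homeomorph.isOpenEmbedding _)
    exact not_isOpenEmbedding_of_mem_open_edge (abs_lt.2 hs) (hedge s (Set.Ioo_subset_Icc_self hs))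
      hU hsO (hplane.comp (hV.isOpenEmbedding_subtypeVal.comp φ.isOpenEmbedding))
  refine ⟨fun t h1 h2 ↦ ⟨hedge t ⟨h1, h2⟩, main t ⟨h1, h2⟩⟩, fun h ↦ ?_⟩
  have h0 : (0 : ℝ) ∈ Set.Icc (-(1 / 2) : ℝ) (1 / 2) := by norm_num
  obtain ⟨U, V, hU, hV, hxU, hφ⟩ := h ⟨_, hedge 0 h0⟩
  exact main 0 h0 U V hU hxU hV hφ
end

section
/- Let B = {(0,0,0), (1,1,1)} ⊆ ℤ³, so that C(B) is the union of two closed unit cubes sharing exactly one vertex, the point (1/2, 1/2, 1/2). Then (1/2, 1/2, 1/2) lies in the frontier of C(B), and no open neighborhood of (1/2, 1/2, 1/2) in the frontier of C(B) (with the subspace topology) is homeomorphic to an open subset of ℝ². In particular the frontier of C(B) is not a topological 2-manifold, i.e. the image with foreground B is not well-composed. (The vertex-adjacency critical configuration; (1/2,1/2,1/2) is a critical vertex.) -/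
/-- The vertex-adjacency configuration: two unit cubes sharing exactly one vertex,
the point `(1/2, 1/2, 1/2)`. -/
def vertexConfig : Set (Fin 3 → ℤ) := {![0, 0, 0], ![1, 1, 1]}

section

open Set Metric Topology

/-- A punctured ball is preconnected in dimension greater than one. -/
theorem isPreconnected_ball_diff_center {E : Type*} [NormedAddCommGroup E] [NormedSpace ℝ E]
    (h : 1 < Module.rank ℝ E) (v : E) (ε : ℝ) : IsPreconnected (ball v ε \ {v}) := by
  have himage : (fun q : ℝ × E => v + q.1 • q.2) '' (Ioo 0 ε ×ˢ sphere (0 : E) 1) =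
      ball v ε \ {v} := by
    ext y
    constructor
    · rintro ⟨⟨r, u⟩, ⟨⟨hr, hrε⟩, hu⟩, rfl⟩
      simp only [mem_sphere_zero_iff_norm] at hu
      have hu0 : u ≠ 0 := by
        rintro rfl
        simp at hu
      simp only at hr hrε
      simp [norm_smul, hu, abs_of_pos hr, hrε, hr.ne', hu0]
    · rintro ⟨hy, hyv⟩
      have hpos : 0 < ‖y - v‖ := norm_pos_iff.2 (sub_ne_zero.2 hyv)
      refine ⟨(‖y - v‖, ‖y - v‖⁻¹ • (y - v)), ⟨⟨hpos, mem_ball_iff_norm.1 hy⟩, ?_⟩, ?_⟩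
      · simp [norm_smul, hpos.ne']
      · simp [smul_smul, hpos.ne']
  rw [← himage]
  exact (isPreconnected_Ioo.prod (isPreconnected_sphere h 0 1)).image _ (by fun_prop)

/-- A point separating its neighborhoods has no neighborhood homeomorphic to an open subset of a
real normed space of dimension greater than one. -/
theorem not_nonempty_homeomorph_of_cut_point {X E : Type*} [TopologicalSpace X]
    [NormedAddCommGroup E] [NormedSpace ℝ E] (hE : 1 < Module.rank ℝ E) {p : X} {φ : X → ℝ}
    (hφ : Continuous φ) (hzero : ∀ x, φ x = 0 → x = p) (hneg : p ∈ closure {x | φ x < 0})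
    (hpos : p ∈ closure {x | 0 < φ x}) {U : Set X} {V : Set E} (hU : IsOpen U) (hp : p ∈ U)
    (hV : IsOpen V) : ¬ Nonempty (U ≃ₜ V) := by
  rintro ⟨f⟩
  set v : V := f ⟨p, hp⟩ with hv
  have hφp : φ p = 0 := by
    refine le_antisymm ?_ ?_
    · exact closure_minimal (fun x (hx : φ x < 0) => hx.le)
        (isClosed_le hφ continuous_const) hneg
    · exact closure_minimal (fun x (hx : 0 < φ x) => hx.le)
        (isClosed_le continuous_const hφ) hpos
  obtain ⟨ε, hε, hball⟩ := Metric.isOpen_iff.1 hV v v.2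
  have hS : IsPreconnected ((↑) ⁻¹' (ball (v : E) ε \ {(v : E)}) : Set V) := by
    rw [← IsInducing.subtypeVal.isPreconnected_image, Subtype.image_preimage_coe,
      inter_eq_right.2 (sdiff_subset.trans hball)]
    exact isPreconnected_ball_diff_center hE _ _
  have hW : IsOpen ((↑) '' (f ⁻¹' ((↑) ⁻¹' ball (v : E) ε)) : Set X) :=
    hU.isOpenMap_subtype_val _
      ((isOpen_ball.preimage continuous_subtype_val).preimage f.continuous)
  have hpW : p ∈ ((↑) '' (f ⁻¹' ((↑) ⁻¹' ball (v : E) ε)) : Set X) :=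
    ⟨⟨p, hp⟩, mem_ball_self hε, rfl⟩
  have key : ∀ a : U, (f a : E) ∈ ball (v : E) ε → φ a ≠ 0 →
      f a ∈ ((↑) ⁻¹' (ball (v : E) ε \ {(v : E)}) : Set V) := by
    refine fun a ha hφa => ⟨ha, fun hav => hφa ?_⟩
    rw [f.injective (Subtype.ext hav : f a = f ⟨p, hp⟩)]
    exact hφp
  obtain ⟨_, ⟨a, ha, rfl⟩, hφa : φ a < 0⟩ := mem_closure_iff.1 hneg _ hW hpW
  obtain ⟨_, ⟨b, hb, rfl⟩, hφb : 0 < φ b⟩ := mem_closure_iff.1 hpos _ hW hpW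
  have hcont : Continuous fun y : V => φ (f.symm y) := by fun_prop
  obtain ⟨y, hy, hy0⟩ := hS.intermediate_value (key a ha hφa.ne) (key b hb hφb.ne')
    hcont.continuousOn (show (0 : ℝ) ∈ _ by simpa using ⟨hφa.le, hφb.le⟩)
  refine hy.2 ?_
  have hfy : f.symm y = ⟨p, hp⟩ := Subtype.ext (hzero _ hy0)
  rw [mem_singleton_iff, hv, ← hfy, f.apply_symm_apply]

theorem mem_contAnalog_vertexConfig {x : Fin 3 → ℝ} : x ∈ contAnalog vertexConfig ↔
    (∀ j, |x j| ≤ 1 / 2) ∨ ∀ j, |x j - 1| ≤ 1 / 2 := by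
  simp [contAnalog, vertexConfig, Fin.forall_fin_succ]

theorem isClosed_contAnalog_vertexConfig : IsClosed (contAnalog vertexConfig) := by
  have h : contAnalog vertexConfig =
      {x | ∀ j, |x j| ≤ 1 / 2} ∪ {x | ∀ j, |x j - 1| ≤ 1 / 2} := by
    ext x
    exact mem_contAnalog_vertexConfig
  rw [h]
  simp only [ofPred_forall]
  exact (isClosed_iInter fun j => isClosed_le (by fun_prop) continuous_const).union
    (isClosed_iInter fun j => isClosed_le (by fun_prop) continuous_const)

/-- The two cubes lie on different sides of the plane `x₀ + x₁ + x₂ = 3 / 2`, which meets them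
only in the shared vertex. -/
theorem eq_vertex_of_sum_eq {x : Fin 3 → ℝ} (hx : x ∈ contAnalog vertexConfig)
    (hsum : x 0 + x 1 + x 2 - 3 / 2 = 0) : x = ![1 / 2, 1 / 2, 1 / 2] := by
  rcases mem_contAnalog_vertexConfig.1 hx with h | h <;>
  · have h0 := abs_le.1 (h 0)
    have h1 := abs_le.1 (h 1)
    have h2 := abs_le.1 (h 2)
    ext j
    fin_cases j <;> simp <;> linarith

/-- A segment through the shared vertex along the third axis lies in the frontier. -/
theorem mem_frontier_contAnalog_vertexConfig {t : ℝ} (ht : |t| ≤ 1) :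
    ![1 / 2, 1 / 2, 1 / 2 + t] ∈ frontier (contAnalog vertexConfig) := by
  rw [frontier_eq_closure_inter_closure]
  obtain ⟨ht₁, ht₂⟩ := abs_le.1 ht
  constructor
  · refine subset_closure (mem_contAnalog_vertexConfig.2 ?_)
    rcases le_total t 0 with h | h
    · left
      simp [Fin.forall_fin_succ, abs_le]
      constructor <;> linarith
    · right
      simp [Fin.forall_fin_succ, abs_le]
      norm_num
      constructor <;> linarith
  · have hlim : Filter.Tendsto (fun s : ℝ => ![1 / 2 + s, 1 / 2 - s, 1 / 2 + t]) (𝓝[>] 0)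
        (𝓝 ![1 / 2, 1 / 2, 1 / 2 + t]) := by
      have hc : Continuous fun s : ℝ => ![1 / 2 + s, 1 / 2 - s, 1 / 2 + t] := by fun_prop
      simpa using (hc.tendsto 0).mono_left nhdsWithin_le_nhds
    refine mem_closure_of_tendsto hlim ?_
    filter_upwards [self_mem_nhdsWithin] with s (hs : 0 < s) hmem
    rcases mem_contAnalog_vertexConfig.1 hmem with h | h
    · have := (abs_le.1 (h 0)).2
      simp at this
      linarith
    · have := (abs_le.1 (h 1)).1
      simp at this
      linarith

/-- Moving along the third axis, the shared vertex is approached within the frontier through any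
set of coordinate sums accumulating at that of the vertex. -/
theorem vertex_mem_closure_of_zero_mem_closure
    (hx : (![1 / 2, 1 / 2, 1 / 2] : Fin 3 → ℝ) ∈ frontier (contAnalog vertexConfig))
    {s : Set ℝ} (hs : (0 : ℝ) ∈ closure s) :
    (⟨![1 / 2, 1 / 2, 1 / 2], hx⟩ : frontier (contAnalog vertexConfig)) ∈
      closure {x : frontier (contAnalog vertexConfig) |
        (x : Fin 3 → ℝ) 0 + (x : Fin 3 → ℝ) 1 + (x : Fin 3 → ℝ) 2 - 3 / 2 ∈ s} := by
  rw [closure_subtype]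
  have hlim : Filter.Tendsto (fun t : ℝ => ![1 / 2, 1 / 2, 1 / 2 + t]) (𝓝 0)
      (𝓝 ![1 / 2, 1 / 2, 1 / 2]) := by
    have hc : Continuous fun t : ℝ => ![1 / 2, 1 / 2, 1 / 2 + t] := by fun_prop
    simpa using hc.tendsto 0
  refine mem_closure_of_frequently_of_tendsto ?_ hlim
  have hsmall : ∀ᶠ t : ℝ in 𝓝 0, |t| ≤ 1 :=
    (continuous_abs.tendsto' 0 0 abs_zero).eventually_le_const one_pos
  refine ((mem_closure_iff_frequently.1 hs).and_eventually hsmall).mono fun t ht => ?_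
  have hsum : (1 / 2 + 1 / 2 + (1 / 2 + t) - 3 / 2 : ℝ) = t := by ring
  refine ⟨⟨_, mem_frontier_contAnalog_vertexConfig ht.2⟩, ?_, rfl⟩
  change 1 / 2 + 1 / 2 + (1 / 2 + t) - 3 / 2 ∈ s
  rw [hsum]
  exact ht.1

end

/-- The shared vertex `(1/2, 1/2, 1/2)` lies in the frontier of `C(B)` and has no open
neighborhood in the frontier homeomorphic to an open subset of `ℝ²`; in particular the
frontier of `C(B)` is not a 2-manifold: the image is not well-composed. -/
theorem vertex_adjacency_not_wellComposed :
    (∃ hx : (![1 / 2, 1 / 2, 1 / 2] : Fin 3 → ℝ) ∈ frontier (contAnalog vertexConfig),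
      ∀ (U : Set (frontier (contAnalog vertexConfig))) (V : Set (Fin 2 → ℝ)),
        IsOpen U →
        (⟨![1 / 2, 1 / 2, 1 / 2], hx⟩ : frontier (contAnalog vertexConfig)) ∈ U →
        IsOpen V → ¬ Nonempty (U ≃ₜ V)) ∧
    ¬ Is2Manifold (frontier (contAnalog vertexConfig)) := by
  have hx : (![1 / 2, 1 / 2, 1 / 2] : Fin 3 → ℝ) ∈ frontier (contAnalog vertexConfig) := by
    simpa using mem_frontier_contAnalog_vertexConfig (t := 0) (by simp)
  have main : ∀ (U : Set (frontier (contAnalog vertexConfig))) (V : Set (Fin 2 → ℝ)),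
      IsOpen U → (⟨![1 / 2, 1 / 2, 1 / 2], hx⟩ : frontier (contAnalog vertexConfig)) ∈ U →
      IsOpen V → ¬ Nonempty (U ≃ₜ V) := by
    intro U V hU hp hV
    have hcoord (j : Fin 3) :
        Continuous fun x : frontier (contAnalog vertexConfig) => (x : Fin 3 → ℝ) j :=
      (continuous_apply j).comp continuous_subtype_val
    have hcont := (((hcoord 0).add (hcoord 1)).add (hcoord 2)).sub
      (continuous_const (y := (3 / 2 : ℝ)))
    refine not_nonempty_homeomorph_of_cut_point (by simp)
      (φ := fun x : frontier (contAnalog vertexConfig) =>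
        (x : Fin 3 → ℝ) 0 + (x : Fin 3 → ℝ) 1 + (x : Fin 3 → ℝ) 2 - 3 / 2)
      hcont (fun x hsum => ?_)
      (vertex_mem_closure_of_zero_mem_closure hx (s := Set.Iio 0) (by simp))
      (vertex_mem_closure_of_zero_mem_closure hx (s := Set.Ioi 0) (by simp)) hU hp hV
    exact Subtype.ext (eq_vertex_of_sum_eq
      (isClosed_contAnalog_vertexConfig.frontier_subset x.2) hsum)
  refine ⟨⟨hx, main⟩, fun hman => ?_⟩
  obtain ⟨U, V, hU, hV, hp, hUV⟩ := hman ⟨_, hx⟩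
  exact main U V hU hp hV hUV
end

section
/- Let B = {0,1}³ \ {(0,0,0), (1,1,1)} ⊆ ℤ³, i.e. six of the eight unit cubes sharing the vertex (1/2, 1/2, 1/2), with the two missing cubes diagonally opposite. Then (1/2, 1/2, 1/2) lies in the frontier of C(B), and no open neighborhood of (1/2, 1/2, 1/2) in the frontier of C(B) (with the subspace topology) is homeomorphic to an open subset of ℝ². In particular the frontier of C(B) is not a topological 2-manifold, i.e. the image with foreground B is not well-composed. (One of the eleven 8-cube configurations around a critical vertex: the complement of the vertex-adjacency configuration.) -/
/-- Six of the eight unit cubes sharing the vertex `(1/2, 1/2, 1/2)`, the two missing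
cubes being diagonally opposite. -/
def sixCubeConfig : Set (Fin 3 → ℤ) :=
  {p | ∀ j, p j = 0 ∨ p j = 1} \ {![0, 0, 0], ![1, 1, 1]}

/-- A point with an open neighborhood homeomorphic to an open subset of a real normed space `E`
has arbitrarily small neighborhoods homeomorphic to `E`. -/
theorem exists_isOpenEmbedding_of_homeomorph {X E : Type*} [TopologicalSpace X]
    [NormedAddCommGroup E] [NormedSpace ℝ E] {U : Set X} {V : Set E} (hU : IsOpen U)
    (hV : IsOpen V) (h : U ≃ₜ V) {x : X} (hx : x ∈ U) {N : Set X} (hN : IsOpen N) (hxN : x ∈ N) :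
    ∃ g : E → X, Topology.IsOpenEmbedding g ∧ g 0 = x ∧ ∀ y, g y ∈ N := by
  have hk : Topology.IsOpenEmbedding (fun v : V => (h.symm v : X)) :=
    hU.isOpenEmbedding_subtypeVal.comp h.symm.isOpenEmbedding
  have hW : IsOpen ((↑) '' ((fun v : V => (h.symm v : X)) ⁻¹' N) : Set E) :=
    hV.isOpenEmbedding_subtypeVal.isOpenMap _ (hN.preimage hk.continuous)
  obtain ⟨r, hr, hball⟩ := Metric.isOpen_iff.1 hW (h ⟨x, hx⟩) ⟨h ⟨x, hx⟩, by simpa, rfl⟩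
  have hmem : ∀ y, OpenPartialHomeomorph.univBall (h ⟨x, hx⟩ : E) r y ∈
      ((↑) '' ((fun v : V => (h.symm v : X)) ⁻¹' N) : Set E) := fun y => hball <| by
    rw [← OpenPartialHomeomorph.univBall_target _ hr]
    exact OpenPartialHomeomorph.map_source _ (by simp)
  have hmemV : ∀ y, OpenPartialHomeomorph.univBall (h ⟨x, hx⟩ : E) r y ∈ V := fun y => by
    obtain ⟨v, -, hv⟩ := hmem y
    exact hv ▸ v.2
  have hu : Topology.IsOpenEmbedding
      (fun y => (⟨_, hmemV y⟩ : V)) :=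
    .of_comp _ hV.isOpenEmbedding_subtypeVal
      (OpenPartialHomeomorph.isOpenEmbedding _
        (OpenPartialHomeomorph.univBall_source (h ⟨x, hx⟩ : E) r))
  refine ⟨_, hk.comp hu, ?_, fun y => ?_⟩
  · simp
  · obtain ⟨v, hvN, hv⟩ := hmem y
    have : (⟨_, hmemV y⟩ : V) = v := Subtype.ext hv.symm
    rw [Function.comp_apply, this]
    exact hvN

theorem mem_contAnalog {B : Set (Fin 3 → ℤ)} {x : Fin 3 → ℝ} :
    x ∈ contAnalog B ↔ ∃ b ∈ B, ∀ j, |x j - (b j : ℝ)| ≤ 1 / 2 := by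
  simp [contAnalog]

theorem notMem_contAnalog_of_half_lt {x : Fin 3 → ℝ} (hx : ∀ j, 1 / 2 < x j) :
    x ∉ contAnalog sixCubeConfig := by
  rw [mem_contAnalog]
  rintro ⟨b, ⟨hb, hb'⟩, h⟩
  refine hb' (Or.inr ?_)
  have key : ∀ j, b j = 1 := fun j => (hb j).resolve_left fun h0 => by
    have := abs_le.1 (h j)
    rw [h0] at this
    push_cast at this
    linarith [hx j]
  ext j
  fin_cases j <;> simp [key]

theorem notMem_contAnalog_of_lt_half {x : Fin 3 → ℝ} (hx : ∀ j, x j < 1 / 2) :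
    x ∉ contAnalog sixCubeConfig := by
  rw [mem_contAnalog]
  rintro ⟨b, ⟨hb, hb'⟩, h⟩
  refine hb' (Or.inl ?_)
  have key : ∀ j, b j = 0 := fun j => (hb j).resolve_right fun h0 => by
    have := abs_le.1 (h j)
    rw [h0] at this
    push_cast at this
    linarith [hx j]
  ext j
  fin_cases j <;> simp [key]

theorem mem_contAnalog_of_le_half_of_half_le {x : Fin 3 → ℝ} (hx : ∀ k, |x k - 1 / 2| ≤ 1)
    {i j : Fin 3} (hij : i ≠ j) (hi : 1 / 2 ≤ x i) (hj : x j ≤ 1 / 2) :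
    x ∈ contAnalog sixCubeConfig := by
  classical
  rw [mem_contAnalog]
  refine ⟨fun k => if k = i then 1 else if k = j then 0 else if 1 / 2 ≤ x k then 1 else 0,
    ⟨fun k => ?_, ?_⟩, fun k => ?_⟩
  · dsimp only
    split_ifs <;> simp
  · rintro (h | h)
    · have := congrFun h i
      fin_cases i <;> simp at this
    · have := congrFun h j
      fin_cases j <;> simp at this <;> exact hij this.symm
  · have := abs_le.1 (hx k)
    rw [abs_le]
    dsimp only
    split_ifs with h1 h2 h3
    · subst h1
      constructor <;> push_cast <;> linarith
    · subst h2
      constructor <;> push_cast <;> linarith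
    · constructor <;> push_cast <;> linarith
    · constructor <;> push_cast <;> linarith

theorem mem_interior_contAnalog {x : Fin 3 → ℝ} (hx : ∀ k, |x k - 1 / 2| < 1)
    {i j : Fin 3} (hi : 1 / 2 < x i) (hj : x j < 1 / 2) :
    x ∈ interior (contAnalog sixCubeConfig) := by
  have hij : i ≠ j := by
    rintro rfl
    linarith
  rw [mem_interior]
  refine ⟨{y | (∀ k, |y k - 1 / 2| < 1) ∧ 1 / 2 < y i ∧ y j < 1 / 2}, ?_, ?_, hx, hi, hj⟩
  · rintro y ⟨hy, hyi, hyj⟩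
    exact mem_contAnalog_of_le_half_of_half_le (fun k => (hy k).le) hij hyi.le hyj.le
  · refine IsOpen.and ?_ (IsOpen.and ?_ ?_)
    · rw [Set.ofPred_forall]
      exact isOpen_iInter_of_finite fun k => isOpen_lt (by fun_prop) continuous_const
    · exact isOpen_lt continuous_const (by fun_prop)
    · exact isOpen_lt (by fun_prop) continuous_const

/-- Near the central vertex, the frontier meets the plane `x₀ + x₁ + x₂ = 3/2` only at that
vertex. -/
theorem eq_half_of_mem_frontier {x : Fin 3 → ℝ}
    (hxf : x ∈ frontier (contAnalog sixCubeConfig)) (hx : ∀ k, |x k - 1 / 2| < 1)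
    (hsum : ∑ k, (x k - 1 / 2) = 0) : x = ![1 / 2, 1 / 2, 1 / 2] := by
  have hall : ∀ k, x k - 1 / 2 = 0 := by
    by_contra! hne
    obtain ⟨k, hk⟩ := hne
    obtain ⟨i, -, hi⟩ := Finset.exists_pos_of_sum_zero_of_exists_nonzero _ hsum
      ⟨k, Finset.mem_univ k, hk⟩
    obtain ⟨j, -, hj⟩ := Finset.exists_pos_of_sum_zero_of_exists_nonzero
      (fun k => -(x k - 1 / 2)) (by rw [Finset.sum_neg_distrib, hsum, neg_zero])
      ⟨k, Finset.mem_univ k, neg_ne_zero.2 hk⟩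
    exact hxf.2 (mem_interior_contAnalog hx (i := i) (j := j) (by linarith) (by linarith))
  ext k
  fin_cases k <;> simpa using sub_eq_zero.1 (hall _)

/-- The frontier contains a segment through the central vertex. -/
theorem mem_frontier_of_abs_le_one {t : ℝ} (ht : |t| ≤ 1) :
    (![1 / 2 + t, 1 / 2, 1 / 2] : Fin 3 → ℝ) ∈ frontier (contAnalog sixCubeConfig) := by
  have hmem : (![1 / 2 + t, 1 / 2, 1 / 2] : Fin 3 → ℝ) ∈ contAnalog sixCubeConfig := by
    refine mem_contAnalog_of_le_half_of_half_le (i := 1) (j := 2) (fun k => ?_) (by decide)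
      (by simp) (by simp)
    fin_cases k <;> simp [ht]
  have hlim (s : ℝ) : Filter.Tendsto (fun ε : ℝ => (![1 / 2 + t + s * ε, 1 / 2 + s * ε,
      1 / 2 + s * ε] : Fin 3 → ℝ)) (nhdsWithin 0 (Set.Ioi 0))
      (nhds ![1 / 2 + t, 1 / 2, 1 / 2]) := by
    refine Filter.Tendsto.mono_left ?_ nhdsWithin_le_nhds
    refine Continuous.tendsto' ?_ _ _ (by simp)
    refine continuous_pi fun k => ?_
    fin_cases k <;> simp <;> fun_prop
  rw [frontier_eq_closure_inter_closure]
  refine ⟨subset_closure hmem, ?_⟩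
  rcases le_total 0 t with h0 | h0
  · refine mem_closure_of_tendsto (hlim 1) ?_
    filter_upwards [self_mem_nhdsWithin] with ε (hε : 0 < ε)
    refine notMem_contAnalog_of_half_lt fun j => ?_
    fin_cases j <;> simp <;> linarith
  · refine mem_closure_of_tendsto (hlim (-1)) ?_
    filter_upwards [self_mem_nhdsWithin] with ε (hε : 0 < ε)
    refine notMem_contAnalog_of_lt_half fun j => ?_
    fin_cases j <;> simp <;> linarith

theorem half_mem_frontier :
    (![1 / 2, 1 / 2, 1 / 2] : Fin 3 → ℝ) ∈ frontier (contAnalog sixCubeConfig) := by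
  simpa using mem_frontier_of_abs_le_one (t := 0) (by simp)

theorem not_nonempty_homeomorph_of_half_mem (U : Set (frontier (contAnalog sixCubeConfig)))
    (V : Set (Fin 2 → ℝ)) (hU : IsOpen U)
    (hcU : (⟨_, half_mem_frontier⟩ : frontier (contAnalog sixCubeConfig)) ∈ U)
    (hV : IsOpen V) : ¬ Nonempty (U ≃ₜ V) := by
  rintro ⟨h⟩
  have hN : IsOpen {x : frontier (contAnalog sixCubeConfig) | ∀ k, |x.1 k - 1 / 2| < 1} := by
    rw [Set.ofPred_forall]
    exact isOpen_iInter_of_finite fun k => isOpen_lt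
      ((((continuous_apply k).comp continuous_subtype_val).sub continuous_const).abs)
      continuous_const
  obtain ⟨g, hg, hg0, hgN⟩ := exists_isOpenEmbedding_of_homeomorph hU hV h hcU hN
    (fun k => by fin_cases k <;> norm_num)
  have hrank : 1 < Module.rank ℝ (Fin 2 → ℝ) := by simp
  have hconn : IsPreconnected ((fun v => ∑ k, ((g v).1 k - 1 / 2)) '' {0}ᶜ) :=
    (isConnected_compl_singleton_of_one_lt_rank hrank 0).isPreconnected.image _
      (continuous_finsetSum _ fun k _ => ((continuous_apply k).comp
        (continuous_subtype_val.comp hg.continuous)).sub continuous_const).continuousOn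
  have hne : (0 : ℝ) ∉ (fun v => ∑ k, ((g v).1 k - 1 / 2)) '' {0}ᶜ := by
    rintro ⟨v, hv, hv0⟩
    refine hv (hg.injective ?_)
    rw [hg0]
    exact Subtype.ext (eq_half_of_mem_frontier (g v).2 (hgN v) hv0)
  obtain ⟨O, hO, hOg⟩ := isOpen_induced_iff.1 hg.isOpen_range
  have hcO : (![1 / 2 + 0, 1 / 2, 1 / 2] : Fin 3 → ℝ) ∈ O := by
    have : (⟨_, half_mem_frontier⟩ : frontier (contAnalog sixCubeConfig)) ∈ Subtype.val ⁻¹' O :=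
      hOg ▸ ⟨0, hg0⟩
    simpa using this
  have hcont : Continuous fun t : ℝ => (![1 / 2 + t, 1 / 2, 1 / 2] : Fin 3 → ℝ) := by
    refine continuous_pi fun k => ?_
    fin_cases k <;> simp <;> fun_prop
  obtain ⟨ε, hε, hεO⟩ := Metric.isOpen_iff.1 (hO.preimage hcont) 0 hcO
  have hsum {t : ℝ} (ht : |t| ≤ 1) (htε : |t| < ε) (ht0 : t ≠ 0) :
      t ∈ (fun v => ∑ k, ((g v).1 k - 1 / 2)) '' {0}ᶜ := by
    have htO : (⟨_, mem_frontier_of_abs_le_one ht⟩ : frontier (contAnalog sixCubeConfig)) ∈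
        Set.range g := hOg ▸ hεO (by simpa using htε)
    obtain ⟨v, hv⟩ := htO
    refine ⟨v, ?_, by simp [hv, Fin.sum_univ_three]; ring⟩
    rintro rfl
    have := congrFun (congrArg Subtype.val (hg0.symm.trans hv)) 0
    simp [ht0] at this
  have hδ : 0 < min 1 (ε / 2) := by positivity
  have habs : |min 1 (ε / 2)| < ε := by
    rw [abs_of_pos hδ]
    exact (min_le_right _ _).trans_lt (by linarith)
  have habs1 : |min 1 (ε / 2)| ≤ 1 := by
    rw [abs_of_pos hδ]
    exact min_le_left _ _
  exact hne <| hconn.ordConnected.out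
    (hsum (t := -min 1 (ε / 2)) (by rwa [abs_neg]) (by rwa [abs_neg]) (by linarith))
    (hsum habs1 habs hδ.ne') ⟨by linarith, hδ.le⟩

/-- The central vertex `(1/2, 1/2, 1/2)` lies in the frontier of `C(B)` and has no open
neighborhood in the frontier homeomorphic to an open subset of `ℝ²`; in particular the
frontier of `C(B)` is not a 2-manifold: the image is not well-composed. -/
theorem sixCube_not_wellComposed :
    (∃ hx : (![1 / 2, 1 / 2, 1 / 2] : Fin 3 → ℝ) ∈ frontier (contAnalog sixCubeConfig),
      ∀ (U : Set (frontier (contAnalog sixCubeConfig))) (V : Set (Fin 2 → ℝ)),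
        IsOpen U →
        (⟨![1 / 2, 1 / 2, 1 / 2], hx⟩ : frontier (contAnalog sixCubeConfig)) ∈ U →
        IsOpen V → ¬ Nonempty (U ≃ₜ V)) ∧
    ¬ Is2Manifold (frontier (contAnalog sixCubeConfig)) := by
  refine ⟨⟨half_mem_frontier, fun U V hU hc hV => not_nonempty_homeomorph_of_half_mem U V hU hc hV⟩,
    fun hM => ?_⟩
  obtain ⟨U, V, hU, hV, hc, h⟩ := hM ⟨_, half_mem_frontier⟩
  exact not_nonempty_homeomorph_of_half_mem U V hU hc hV h
end
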